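/- arXiv:2206.03444 — 3 statements merged into one kernel-verified Lean document; each statement's English description precedes it below -/
import Mathlib

section
/- Let 0 < λ ≤ 2^{-6}, let P ∈ ℂ^{L×L} with ‖P‖ ≤ 1, and let Q ∈ 𝔾_{L,w}. Define X(Q,P) := Q^⊥PQ + QP*Q^⊥, Y(Q,P) := Q^⊥PQP*Q^⊥ − QP*Q^⊥PQ + ½[Q^⊥P(Q^⊥−Q)PQ + QP*(Q^⊥−Q)P*Q^⊥], and Z^{(λ)}(Q,P) := λ^{-3}(e^{λP}·Q − Q − λX(Q,P) − λ²Y(Q,P)). Then ‖X(Q,P)‖ ≤ 1, ‖Y(Q,P)‖ ≤ 3/2, ‖Z^{(λ)}(Q,P)‖ ≤ 20, and for any orthogonal projection Q′ with QQ′ = 0 one has rank(X(Q+Q′,P) − X(Q,P)) ≤ 2·rank(Q′), rank(Y(Q+Q′,P) − Y(Q,P)) ≤ 3·rank(Q′), and rank(Z^{(λ)}(Q+Q′,P) − Z^{(λ)}(Q,P)) ≤ 4·rank(Q′). -/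
open Matrix BigOperators

noncomputable section

/-- The squared Euclidean norm of a complex vector. -/
def sqNorm {n : ℕ} (v : Fin n → ℂ) : ℝ := ∑ i, ‖v i‖ ^ 2

/-- The Euclidean norm of a complex vector. -/
def vNorm {n : ℕ} (v : Fin n → ℂ) : ℝ := Real.sqrt (sqNorm v)

/-- The `ℓ² → ℓ²` operator norm of a rectangular complex matrix. -/
def opNorm {m n : ℕ} (A : Matrix (Fin m) (Fin n) ℂ) : ℝ :=
  ‖LinearMap.toContinuousLinearMap (Matrix.toEuclideanLin A)‖

/-- Membership in the Grassmannian `𝔾_{L,q}`: an orthogonal projection of rank `q`. -/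
def IsProjOfRank {L : ℕ} (q : ℕ) (Q : Matrix (Fin L) (Fin L) ℂ) : Prop :=
  Q * Q = Q ∧ Qᴴ = Q ∧ Q.trace = (q : ℂ)

/-- The action `T · Q` of an invertible matrix `T` on the Grassmannian: for `Q = ΦΦ*` this
equals `TΦ(Φ*T*TΦ)⁻¹Φ*T*`, i.e. the orthogonal projection onto `T (ran Q)`. -/
def grAct {L : ℕ} (T Q : Matrix (Fin L) (Fin L) ℂ) : Matrix (Fin L) (Fin L) ℂ :=
  T * Q * (Q * Tᴴ * T * Q + (1 - Q))⁻¹ * (Q * Tᴴ)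

/-- The matrix exponential. -/
def mexp {n : ℕ} (A : Matrix (Fin n) (Fin n) ℂ) : Matrix (Fin n) (Fin n) ℂ :=
  ∑' k : ℕ, ((k.factorial : ℂ))⁻¹ • A ^ k

/-- `X(Q,P) = Q^⊥ P Q + Q P* Q^⊥`. -/
def Xmap {L : ℕ} (Q P : Matrix (Fin L) (Fin L) ℂ) : Matrix (Fin L) (Fin L) ℂ :=
  (1 - Q) * P * Q + Q * Pᴴ * (1 - Q)

/-- `Y(Q,P) = Q^⊥PQP*Q^⊥ − QP*Q^⊥PQ + ½[Q^⊥P(Q^⊥−Q)PQ + QP*(Q^⊥−Q)P*Q^⊥]`. -/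
def Ymap {L : ℕ} (Q P : Matrix (Fin L) (Fin L) ℂ) : Matrix (Fin L) (Fin L) ℂ :=
  (1 - Q) * P * Q * Pᴴ * (1 - Q) - Q * Pᴴ * (1 - Q) * P * Q
    + (2 : ℂ)⁻¹ • ((1 - Q) * P * ((1 - Q) - Q) * P * Q + Q * Pᴴ * ((1 - Q) - Q) * Pᴴ * (1 - Q))

/-- `Z^{(λ)}(Q,P) = λ^{-3}(e^{λP}·Q − Q − λX(Q,P) − λ²Y(Q,P))`. -/
def Zmap {L : ℕ} (lam : ℝ) (Q P : Matrix (Fin L) (Fin L) ℂ) : Matrix (Fin L) (Fin L) ℂ :=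
  ((lam : ℂ) ^ 3)⁻¹ •
    (grAct (mexp ((lam : ℂ) • P)) Q - Q - (lam : ℂ) • Xmap Q P - ((lam : ℂ) ^ 2) • Ymap Q P)

section Helpers

set_option linter.unusedSimpArgs false

open scoped Matrix.Norms.L2Operator

variable {L : ℕ}

lemma opNorm_eq (A : Matrix (Fin L) (Fin L) ℂ) : opNorm A = ‖A‖ := rfl

lemma mexp_eq (A : Matrix (Fin L) (Fin L) ℂ) : mexp A = NormedSpace.exp A := by
  rw [NormedSpace.exp_eq_tsum ℂ]; rfl

lemma proj_norm {Q : Matrix (Fin L) (Fin L) ℂ} (h1 : Q * Q = Q) (h2 : Qᴴ = Q) : ‖Q‖ ≤ 1 :=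
  IsStarProjection.norm_le Q ⟨h1, h2⟩

lemma compl_idem {Q : Matrix (Fin L) (Fin L) ℂ} (h1 : Q * Q = Q) :
    (1 - Q) * (1 - Q) = 1 - Q := by
  simp [mul_sub, sub_mul, h1]

lemma compl_herm {Q : Matrix (Fin L) (Fin L) ℂ} (h2 : Qᴴ = Q) : (1 - Q)ᴴ = 1 - Q := by
  simp [h2]

lemma nmul {A B : Matrix (Fin L) (Fin L) ℂ} {a b : ℝ} (hA : ‖A‖ ≤ a) (hB : ‖B‖ ≤ b) :
    ‖A * B‖ ≤ a * b :=
  (norm_mul_le A B).trans (mul_le_mul hA hB (norm_nonneg _) ((norm_nonneg _).trans hA))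

lemma nadd {A B : Matrix (Fin L) (Fin L) ℂ} {a b : ℝ} (hA : ‖A‖ ≤ a) (hB : ‖B‖ ≤ b) :
    ‖A + B‖ ≤ a + b := (norm_add_le A B).trans (add_le_add hA hB)

lemma nsub {A B : Matrix (Fin L) (Fin L) ℂ} {a b : ℝ} (hA : ‖A‖ ≤ a) (hB : ‖B‖ ≤ b) :
    ‖A - B‖ ≤ a + b := (norm_sub_le A B).trans (add_le_add hA hB)

lemma nmul1 {A B : Matrix (Fin L) (Fin L) ℂ} (hA : ‖A‖ ≤ 1) (hB : ‖B‖ ≤ 1) :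
    ‖A * B‖ ≤ 1 := by simpa using nmul hA hB

lemma exp_rem (A : Matrix (Fin L) (Fin L) ℂ) (hA : ‖A‖ ≤ 1 / 2) :
    ‖NormedSpace.exp A - (1 + A + (2 : ℂ)⁻¹ • (A * A))‖ ≤ ‖A‖ ^ 3 := by
  have hs := NormedSpace.expSeries_summable' (𝕂 := ℂ) A
  have h := hs.sum_add_tsum_nat_add 3
  have e : NormedSpace.exp A = ∑' n : ℕ, ((n.factorial : ℂ)⁻¹) • A ^ n := by
    rw [NormedSpace.exp_eq_tsum ℂ]
  rw [e, ← h]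
  simp only [Finset.sum_range_succ, Finset.sum_range_zero]
  have : (0 + ((Nat.factorial 0 : ℂ)⁻¹) • A ^ 0 + ((Nat.factorial 1 : ℂ)⁻¹) • A ^ 1
      + ((Nat.factorial 2 : ℂ)⁻¹) • A ^ 2) = 1 + A + (2 : ℂ)⁻¹ • (A * A) := by
    simp [Nat.factorial, pow_two]
  rw [this, add_sub_cancel_left]
  have hg : HasSum (fun n : ℕ => ‖A‖ ^ 3 / 6 * ‖A‖ ^ n) (‖A‖ ^ 3 / 6 * (1 - ‖A‖)⁻¹) :=
    (hasSum_geometric_of_lt_one (norm_nonneg _) (by linarith)).mul_left _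
  refine (tsum_of_norm_bounded hg ?_).trans ?_
  · intro n
    rw [norm_smul]
    have h1 : ‖A ^ (n + 3)‖ ≤ ‖A‖ ^ (n + 3) := norm_pow_le' _ (by omega)
    have h2 : ‖(((n + 3).factorial : ℂ)⁻¹)‖ ≤ 1 / 6 := by
      rw [norm_inv, Complex.norm_natCast, one_div]
      have : (6 : ℝ) ≤ ((n + 3).factorial : ℝ) := by
        exact_mod_cast (Nat.factorial_le (show 3 ≤ n + 3 by omega) : Nat.factorial 3 ≤ _)
      gcongr
    calc _ ≤ 1 / 6 * ‖A‖ ^ (n + 3) := by gcongr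
      _ = _ := by ring
  · have : (1 - ‖A‖)⁻¹ ≤ 2 := by
      rw [inv_le_comm₀ (by linarith) (by norm_num)]; linarith
    have h3 : 0 ≤ ‖A‖ ^ 3 := by positivity
    nlinarith

/-- Pythagoras for an orthogonal projection. -/
lemma pyth {Q : Matrix (Fin L) (Fin L) ℂ} (h1 : Q * Q = Q) (h2 : Qᴴ = Q)
    (a b : EuclideanSpace ℂ (Fin L)) :
    ‖toEuclideanCLM (n := Fin L) (𝕜 := ℂ) Q a +
      toEuclideanCLM (n := Fin L) (𝕜 := ℂ) (1 - Q) b‖ ^ 2 =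
    ‖toEuclideanCLM (n := Fin L) (𝕜 := ℂ) Q a‖ ^ 2 +
      ‖toEuclideanCLM (n := Fin L) (𝕜 := ℂ) (1 - Q) b‖ ^ 2 := by
  have : inner ℂ (toEuclideanCLM (n := Fin L) (𝕜 := ℂ) Q a)
      (toEuclideanCLM (n := Fin L) (𝕜 := ℂ) (1 - Q) b) = 0 := by
    rw [← ContinuousLinearMap.adjoint_inner_right, ← ContinuousLinearMap.star_eq_adjoint,
      ← map_star, Matrix.star_eq_conjTranspose, h2, ← mul_apply_eq_comp, ← map_mul]
    simp [mul_sub, h1]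
  have := norm_add_sq_eq_norm_sq_add_norm_sq_of_inner_eq_zero _ _ this
  simpa [pow_two] using this

lemma block_norm {E F A B : Matrix (Fin L) (Fin L) ℂ} (hE1 : E * E = E) (hE2 : Eᴴ = E)
    (hF1 : F * F = F) (hF2 : Fᴴ = F) {c : ℝ} (hc : 0 ≤ c) (hA : ‖A‖ ≤ c) (hB : ‖B‖ ≤ c) :
    ‖E * A * F + (1 - E) * B * (1 - F)‖ ≤ c := by
  rw [Matrix.cstar_norm_def]
  refine ContinuousLinearMap.opNorm_le_bound _ hc fun v => ?_
  refine le_of_sq_le_sq ?_ (by positivity)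
  have h0 := pyth hF1 hF2 v v
  have hv : toEuclideanCLM (n := Fin L) (𝕜 := ℂ) F v +
      toEuclideanCLM (n := Fin L) (𝕜 := ℂ) (1 - F) v = v := by
    simp [map_sub]
  rw [hv] at h0
  have hsplit : toEuclideanCLM (n := Fin L) (𝕜 := ℂ) (E * A * F + (1 - E) * B * (1 - F)) v =
      toEuclideanCLM (n := Fin L) (𝕜 := ℂ) E (toEuclideanCLM (n := Fin L) (𝕜 := ℂ) A
        (toEuclideanCLM (n := Fin L) (𝕜 := ℂ) F v)) +
      toEuclideanCLM (n := Fin L) (𝕜 := ℂ) (1 - E) (toEuclideanCLM (n := Fin L) (𝕜 := ℂ) B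
        (toEuclideanCLM (n := Fin L) (𝕜 := ℂ) (1 - F) v)) := by
    rw [map_add, map_mul, map_mul, map_mul (toEuclideanCLM) ((1 - E) * B),
      map_mul (toEuclideanCLM) (1 - E)]
    rfl
  rw [hsplit, pyth hE1 hE2, mul_pow, h0]
  have key : ∀ (G A F : Matrix (Fin L) (Fin L) ℂ), ‖G‖ ≤ 1 → ‖A‖ ≤ c →
      ‖toEuclideanCLM (n := Fin L) (𝕜 := ℂ) G (toEuclideanCLM (n := Fin L) (𝕜 := ℂ) A
        (toEuclideanCLM (n := Fin L) (𝕜 := ℂ) F v))‖ ≤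
      c * ‖toEuclideanCLM (n := Fin L) (𝕜 := ℂ) F v‖ := by
    intro G A F hG hA
    rw [Matrix.cstar_norm_def] at hG hA
    have a1 := ContinuousLinearMap.le_of_opNorm_le _ hG (toEuclideanCLM (n := Fin L) (𝕜 := ℂ) A
        (toEuclideanCLM (n := Fin L) (𝕜 := ℂ) F v))
    have a2 := ContinuousLinearMap.le_of_opNorm_le _ hA (toEuclideanCLM (n := Fin L) (𝕜 := ℂ) F v)
    linarith
  have k1 := key E A F (proj_norm hE1 hE2) hA
  have k2 := key (1 - E) B (1 - F) (proj_norm (compl_idem hE1) (compl_herm hE2)) hB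
  have k1' := pow_le_pow_left₀ (norm_nonneg _) k1 2
  have k2' := pow_le_pow_left₀ (norm_nonneg _) k2 2
  linarith [mul_pow c ‖toEuclideanCLM (n := Fin L) (𝕜 := ℂ) F v‖ 2,
    mul_pow c ‖toEuclideanCLM (n := Fin L) (𝕜 := ℂ) (1 - F) v‖ 2]

variable {P Q : Matrix (Fin L) (Fin L) ℂ}

lemma X_norm (h1 : Q * Q = Q) (h2 : Qᴴ = Q) (hP : ‖P‖ ≤ 1) : ‖Xmap Q P‖ ≤ 1 := by
  have hP' : ‖Pᴴ‖ ≤ 1 := by rwa [Matrix.l2_opNorm_conjTranspose]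
  have := block_norm (A := Pᴴ) (B := P) h1 h2 (compl_idem h1) (compl_herm h2) zero_le_one hP' hP
  rw [sub_sub_cancel, add_comm] at this
  exact this

lemma Y_norm (h1 : Q * Q = Q) (h2 : Qᴴ = Q) (hP : ‖P‖ ≤ 1) : ‖Ymap Q P‖ ≤ 3 / 2 := by
  have hP' : ‖Pᴴ‖ ≤ 1 := by rwa [Matrix.l2_opNorm_conjTranspose]
  have hQ := proj_norm h1 h2
  have hE := proj_norm (compl_idem h1) (compl_herm h2)
  have hD : ‖(1 - Q) - Q‖ ≤ 1 := by
    have h : ‖(1 : Matrix (Fin L) (Fin L) ℂ)‖ ≤ 1 := proj_norm (by simp) (by simp)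
    have := block_norm (A := -1) (B := 1) h1 h2 h1 h2 zero_le_one (by simpa using h) h
    have e : Q * (-1) * Q + (1 - Q) * 1 * (1 - Q) = (1 - Q) - Q := by
      simp [mul_sub, sub_mul, h1]; abel
    rwa [e] at this
  have hd := block_norm (A := -(Pᴴ * (1 - Q) * P)) (B := P * Q * Pᴴ) h1 h2 h1 h2 zero_le_one
    (by rw [norm_neg]; exact nmul1 (nmul1 hP' hE) hP) (nmul1 (nmul1 hP hQ) hP')
  have ho := block_norm (A := Pᴴ * ((1 - Q) - Q) * Pᴴ) (B := P * ((1 - Q) - Q) * P) h1 h2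
    (compl_idem h1) (compl_herm h2) zero_le_one
    (nmul1 (nmul1 hP' hD) hP') (nmul1 (nmul1 hP hD) hP)
  have e : Ymap Q P = (Q * (-(Pᴴ * (1 - Q) * P)) * Q + (1 - Q) * (P * Q * Pᴴ) * (1 - Q)) +
      (2 : ℂ)⁻¹ • (Q * (Pᴴ * ((1 - Q) - Q) * Pᴴ) * (1 - Q) +
        (1 - Q) * (P * ((1 - Q) - Q) * P) * (1 - (1 - Q))) := by
    rw [sub_sub_cancel, Ymap]
    simp only [mul_assoc, mul_neg, neg_mul]
    module
  rw [e]
  refine (nadd hd (b := 1 / 2) ?_).trans (by norm_num)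
  rw [norm_smul, norm_inv, Complex.norm_ofNat]
  linarith

lemma idem_mul (h1 : Q * Q = Q) (A : Matrix (Fin L) (Fin L) ℂ) : Q * (Q * A) = Q * A := by
  rw [← mul_assoc, h1]

lemma approx (h1 : Q * Q = Q) (h2 : Qᴴ = Q) (hP : ‖P‖ ≤ 1) {lam : ℝ} (hl0 : 0 < lam)
    (hl : lam ≤ 1 / 64) {T : Matrix (Fin L) (Fin L) ℂ}
    (hT : ‖T - (1 + (lam : ℂ) • P + (2 : ℂ)⁻¹ • (((lam : ℂ) • P) * ((lam : ℂ) • P)))‖ ≤ lam ^ 3) :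
    ∃ B, ‖Q + (lam : ℂ) • Xmap Q P + ((lam : ℂ) ^ 2) • Ymap Q P - T * Q * B‖ ≤ 7 * lam ^ 3 := by
  have hP' : ‖Pᴴ‖ ≤ 1 := by rwa [Matrix.l2_opNorm_conjTranspose]
  have hQ := proj_norm h1 h2
  have hE := proj_norm (compl_idem h1) (compl_herm h2)
  have h11 : ‖(1 : Matrix (Fin L) (Fin L) ℂ)‖ ≤ 1 := proj_norm (by simp) (by simp)
  have hY := Y_norm h1 h2 hP
  have hll : ‖(lam : ℂ)‖ = lam := by
    rw [Complex.norm_real, Real.norm_of_nonneg hl0.le]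
  obtain ⟨R, hR⟩ : ∃ R, R = T - (1 + (lam : ℂ) • P +
    (2 : ℂ)⁻¹ • (((lam : ℂ) • P) * ((lam : ℂ) • P))) := ⟨_, rfl⟩
  rw [← hR] at hT
  have hTe : T = 1 + (lam : ℂ) • P + (2 : ℂ)⁻¹ • (((lam : ℂ) • P) * ((lam : ℂ) • P)) + R := by
    rw [hR]; abel
  obtain ⟨b1, hb1⟩ : ∃ b, b = Pᴴ * (1 - Q) - P * Q := ⟨_, rfl⟩
  obtain ⟨b2, hb2⟩ : ∃ b, b = Ymap Q P - (2 : ℂ)⁻¹ • (P * P * Q) - P * Q * b1 := ⟨_, rfl⟩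
  have nb1 : ‖b1‖ ≤ 2 := by
    rw [hb1]; exact (nsub (nmul1 hP' hE) (nmul1 hP hQ)).trans (by norm_num)
  have nhalf : ∀ {A : Matrix (Fin L) (Fin L) ℂ} {a : ℝ}, ‖A‖ ≤ a →
      ‖(2 : ℂ)⁻¹ • A‖ ≤ a / 2 := by
    intro A a hA
    rw [norm_smul, norm_inv, Complex.norm_ofNat]; linarith
  have nl : ∀ (k : ℕ) {A : Matrix (Fin L) (Fin L) ℂ} {a : ℝ}, ‖A‖ ≤ a →
      ‖((lam : ℂ) ^ k) • A‖ ≤ lam ^ k * a := by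
    intro k A a hA
    rw [norm_smul, norm_pow, hll]; gcongr
  have nb2 : ‖b2‖ ≤ 4 := by
    rw [hb2]
    exact (nsub (nsub hY (nhalf (nmul1 (nmul1 hP hP) hQ))) (nmul (nmul1 hP hQ) nb1)).trans
      (by norm_num)
  have eX : Xmap Q P = P * Q + Q * b1 := by
    rw [hb1, Xmap]
    simp only [mul_sub, sub_mul, mul_assoc, mul_one, one_mul]
    abel
  have eY : Ymap Q P = (2 : ℂ)⁻¹ • (P * P * Q) + P * Q * b1 + Q * b2 := by
    rw [hb2, hb1, Ymap]
    simp only [mul_sub, sub_mul, mul_add, add_mul, mul_assoc, mul_one, one_mul, h1, idem_mul h1,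
      smul_sub, smul_add, mul_smul_comm]
    module
  refine ⟨1 + ((lam : ℂ) ^ 1) • b1 + ((lam : ℂ) ^ 2) • b2, ?_⟩
  have nB : ‖1 + ((lam : ℂ) ^ 1) • b1 + ((lam : ℂ) ^ 2) • b2‖ ≤ 1 + lam ^ 1 * 2 + lam ^ 2 * 4 :=
    nadd (nadd h11 (nl 1 nb1)) (nl 2 nb2)
  have e : Q + (lam : ℂ) • Xmap Q P + ((lam : ℂ) ^ 2) • Ymap Q P -
      T * Q * (1 + ((lam : ℂ) ^ 1) • b1 + ((lam : ℂ) ^ 2) • b2) =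
      -(((lam : ℂ) ^ 3) • ((2 : ℂ)⁻¹ • (P * P * Q * b1) + P * Q * b2) +
        ((lam : ℂ) ^ 4) • ((2 : ℂ)⁻¹ • (P * P * Q * b2)) +
        R * Q * (1 + ((lam : ℂ) ^ 1) • b1 + ((lam : ℂ) ^ 2) • b2)) := by
    rw [eX, eY, hTe]
    clear hb1 hb2 eX eY hTe
    simp only [mul_add, add_mul, mul_assoc, mul_one, one_mul,
      smul_add, mul_smul_comm, smul_mul_assoc]
    module
  rw [e, norm_neg]
  refine (nadd (nadd (nl 3 (nadd (nhalf (nmul (nmul1 (nmul1 hP hP) hQ) nb1))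
    (nmul (nmul1 hP hQ) nb2))) (nl 4 (nhalf (nmul (nmul1 (nmul1 hP hP) hQ) nb2))))
    (nmul (nmul hT hQ) nB)).trans ?_
  have h3 : 0 < lam ^ 3 := by positivity
  have hl2 : lam ^ 2 ≤ 1 / 64 := by nlinarith
  have : lam ^ 3 * (1 * 2 / 2 + 1 * 4) + lam ^ 4 * (1 * 4 / 2) +
      lam ^ 3 * 1 * (1 + lam ^ 1 * 2 + lam ^ 2 * 4) =
      lam ^ 3 * (6 + lam * 4 + lam ^ 2 * 4) := by ring
  rw [this]
  nlinarith

open scoped ComplexOrder in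
lemma gr_unit (h1 : Q * Q = Q) {T S : Matrix (Fin L) (Fin L) ℂ} (hS : S * T = 1)
    (h2 : Qᴴ = Q) : IsUnit (Q * Tᴴ * T * Q + (1 - Q)) := by
  rw [← Matrix.mulVec_injective_iff_isUnit]
  have h0 : ∀ v : Fin L → ℂ, (Q * Tᴴ * T * Q + (1 - Q)) *ᵥ v = 0 → v = 0 := by
    intro v hv
    have e1 : (1 - Q) * (Q * Tᴴ * T * Q + (1 - Q)) = 1 - Q := by
      simp only [mul_sub, sub_mul, mul_add, mul_assoc, mul_one, one_mul, h1, idem_mul h1]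
      abel
    have e2 : Q * (Q * Tᴴ * T * Q + (1 - Q)) = (T * Q)ᴴ * (T * Q) := by
      rw [conjTranspose_mul, h2]
      simp only [mul_sub, mul_add, mul_assoc, mul_one, h1, idem_mul h1]
      abel
    have a1 : (1 - Q) *ᵥ v = 0 := by rw [← e1, ← mulVec_mulVec, hv, mulVec_zero]
    have a2 : ((T * Q)ᴴ * (T * Q)) *ᵥ v = 0 := by rw [← e2, ← mulVec_mulVec, hv, mulVec_zero]
    rw [Matrix.conjTranspose_mul_self_mulVec_eq_zero] at a2
    have a3 : Q *ᵥ v = 0 := by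
      have : Q = S * (T * Q) := by rw [← mul_assoc, hS, one_mul]
      rw [this, ← mulVec_mulVec, a2, mulVec_zero]
    rw [sub_mulVec, one_mulVec, a3, sub_zero] at a1
    exact a1
  intro a b hab
  have := h0 (a - b) (by rw [mulVec_sub]; exact sub_eq_zero.mpr hab)
  exact sub_eq_zero.mp this

lemma gr_herm (T : Matrix (Fin L) (Fin L) ℂ) (h2 : Qᴴ = Q) : (grAct T Q)ᴴ = grAct T Q := by
  simp only [grAct, conjTranspose_mul, conjTranspose_nonsing_inv, conjTranspose_add,
    conjTranspose_sub, conjTranspose_one, conjTranspose_conjTranspose, h2, mul_assoc]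

lemma gr_fix (h1 : Q * Q = Q) {T S : Matrix (Fin L) (Fin L) ℂ} (hS : S * T = 1)
    (h2 : Qᴴ = Q) : grAct T Q * (T * Q) = T * Q := by
  have hu := gr_unit h1 hS h2
  rw [Matrix.isUnit_iff_isUnit_det] at hu
  have e : (Q * Tᴴ * T * Q + (1 - Q)) * Q = Q * Tᴴ * (T * Q) := by
    simp only [sub_mul, add_mul, mul_assoc, one_mul, h1]
    abel
  rw [grAct, mul_assoc _ (Q * Tᴴ), ← e, mul_assoc (T * Q), ← mul_assoc _ _ Q,
    Matrix.nonsing_inv_mul _ hu, one_mul, mul_assoc, h1]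

lemma gr_idem (h1 : Q * Q = Q) {T S : Matrix (Fin L) (Fin L) ℂ} (hS : S * T = 1)
    (h2 : Qᴴ = Q) : grAct T Q * grAct T Q = grAct T Q := by
  conv_lhs => rhs; rw [grAct, mul_assoc (T * Q)]
  rw [← mul_assoc, gr_fix h1 hS h2, grAct, mul_assoc (T * Q)]

lemma gr_kill (h1 : Q * Q = Q) {T S : Matrix (Fin L) (Fin L) ℂ} (hS : Tᴴ * S = 1) :
    grAct T Q * (S * (1 - Q)) = 0 := by
  rw [grAct, mul_assoc _ (Q * Tᴴ), mul_assoc Q Tᴴ (S * (1 - Q)), ← mul_assoc Tᴴ S, hS, one_mul, mul_sub, h1]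
  simp

lemma exp_smul_rem (hP : ‖P‖ ≤ 1) {c : ℂ} {lam : ℝ} (hc : ‖c‖ = lam) (hl : lam ≤ 1 / 64) :
    ‖NormedSpace.exp (c • P) - (1 + c • P + (2 : ℂ)⁻¹ • ((c • P) * (c • P)))‖ ≤ lam ^ 3 := by
  have h : ‖c • P‖ ≤ lam := by
    rw [norm_smul, hc]
    have : 0 ≤ lam := hc ▸ norm_nonneg c
    nlinarith
  exact (exp_rem _ (by linarith)).trans (by gcongr)

lemma X_dual : Xmap (1 - Q) (-Pᴴ) = -Xmap Q P := by
  simp only [Xmap, sub_sub_cancel, conjTranspose_neg, conjTranspose_conjTranspose, mul_neg,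
    neg_mul]
  abel

lemma Y_dual : Ymap (1 - Q) (-Pᴴ) = -Ymap Q P := by
  simp only [Ymap, sub_sub_cancel, conjTranspose_neg, conjTranspose_conjTranspose, mul_neg,
    neg_mul, neg_neg]
  simp only [mul_sub, sub_mul, mul_assoc, mul_one, one_mul]
  module

lemma Z_norm (h1 : Q * Q = Q) (h2 : Qᴴ = Q) (hP : ‖P‖ ≤ 1) {lam : ℝ} (hl0 : 0 < lam)
    (hl : lam ≤ 1 / 64) : ‖Zmap lam Q P‖ ≤ 20 := by
  have hll : ‖(lam : ℂ)‖ = lam := by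
    rw [Complex.norm_real, Real.norm_of_nonneg hl0.le]
  have hP' : ‖-Pᴴ‖ ≤ 1 := by rwa [norm_neg, Matrix.l2_opNorm_conjTranspose]
  obtain ⟨T, hT⟩ : ∃ T, T = NormedSpace.exp ((lam : ℂ) • P) := ⟨_, rfl⟩
  obtain ⟨S, hS⟩ : ∃ S, S = NormedSpace.exp ((lam : ℂ) • (-Pᴴ)) := ⟨_, rfl⟩
  have hTS : Tᴴ * S = 1 := by
    rw [hT, hS, ← Matrix.exp_conjTranspose, smul_neg, Matrix.exp_neg, conjTranspose_smul]
    simp only [Complex.star_def, Complex.conj_ofReal]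
    exact Matrix.mul_nonsing_inv _ ((Matrix.isUnit_iff_isUnit_det _).1 (Matrix.isUnit_exp _))
  have hTS' : Sᴴ * T = 1 := by
    have := congrArg conjTranspose hTS
    simpa using this
  obtain ⟨B1, hB1⟩ := approx (T := T) h1 h2 hP hl0 hl (hT ▸ exp_smul_rem hP hll hl)
  obtain ⟨B2, hB2⟩ := approx (T := S) (compl_idem h1) (compl_herm h2) hP' hl0 hl
    (hS ▸ exp_smul_rem hP' hll hl)
  rw [X_dual, Y_dual] at hB2
  rw [Zmap, mexp_eq, ← hT]
  have g1 := gr_idem h1 hTS' h2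
  have g2 := gr_herm T h2
  have g3 := gr_fix h1 hTS' h2
  have g4 := gr_kill (S := S) h1 hTS
  generalize grAct T Q = G at *
  have e : G - Q - (lam : ℂ) • Xmap Q P - ((lam : ℂ) ^ 2) • Ymap Q P =
      G * (1 - Q + (lam : ℂ) • -Xmap Q P + ((lam : ℂ) ^ 2) • -Ymap Q P - S * (1 - Q) * B2) -
      (1 - G) * (Q + (lam : ℂ) • Xmap Q P + ((lam : ℂ) ^ 2) • Ymap Q P - T * Q * B1) := by
    rw [mul_sub G, ← mul_assoc G, g4, mul_sub (1 - G), ← mul_assoc (1 - G), sub_mul 1 G (T * Q), g3]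
    simp only [mul_sub, sub_mul, mul_add, mul_one, one_mul, mul_smul_comm, sub_self, zero_mul,
      smul_neg, mul_neg]
    module
  have hb : ‖G - Q - (lam : ℂ) • Xmap Q P - ((lam : ℂ) ^ 2) • Ymap Q P‖ ≤ 14 * lam ^ 3 := by
    rw [e]
    refine (nsub (nmul (proj_norm g1 g2) hB2)
      (nmul (proj_norm (compl_idem g1) (compl_herm g2)) hB1)).trans (le_of_eq (by ring))
  rw [norm_smul, norm_inv, norm_pow, hll]
  have h3 : 0 < lam ^ 3 := by positivity
  rw [inv_mul_le_iff₀ h3]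
  linarith

/-! Rank bounds -/

lemma rk_add (A B : Matrix (Fin L) (Fin L) ℂ) : (A + B).rank ≤ A.rank + B.rank := by
  unfold Matrix.rank
  rw [Matrix.mulVecLin_add]
  exact (Submodule.finrank_mono (LinearMap.range_add_le _ _)).trans
    (Submodule.finrank_add_le_finrank_add_finrank _ _)

lemma rk_mid (A C B : Matrix (Fin L) (Fin L) ℂ) : (A * C * B).rank ≤ C.rank :=
  (Matrix.rank_mul_le_left _ _).trans (Matrix.rank_mul_le_right _ _)

lemma rk_smul (c : ℂ) (A : Matrix (Fin L) (Fin L) ℂ) : (c • A).rank ≤ A.rank := by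
  have : c • A = (c • 1) * A := by simp
  rw [this]; exact Matrix.rank_mul_le_right _ _

lemma rk_sub (A B : Matrix (Fin L) (Fin L) ℂ) : (A - B).rank ≤ A.rank + B.rank := by
  have : A - B = A + (-1 : ℂ) • B := by simp [sub_eq_add_neg]
  rw [this]
  exact (rk_add _ _).trans (Nat.add_le_add_left (rk_smul _ _) _)

/-- Compressing by `1 - Q'` on both sides loses at most `2 rank Q'`. -/
lemma rk_compress (C S : Matrix (Fin L) (Fin L) ℂ) :
    S.rank ≤ 2 * C.rank + ((1 - C) * S * (1 - C)).rank := by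
  have e : S = 1 * C * S + ((1 - C) * S) * C * 1 + (1 - C) * S * (1 - C) := by
    simp only [mul_sub, sub_mul, mul_one, one_mul]
    abel
  have a1 := rk_add (1 * C * S + ((1 - C) * S) * C * 1) ((1 - C) * S * (1 - C))
  have a2 := rk_add (1 * C * S) (((1 - C) * S) * C * 1)
  have a3 := rk_mid 1 C S
  have a4 := rk_mid ((1 - C) * S) C 1
  rw [← e] at a1
  omega

variable {C : Matrix (Fin L) (Fin L) ℂ}

lemma X_compress (h1 : Q * Q = Q) (c1 : C * C = C) (hQC : Q * C = 0) (hCQ : C * Q = 0) :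
    (1 - C) * (Xmap (Q + C) P - Xmap Q P) * (1 - C) = 0 := by
  have q1 := idem_mul h1
  have q2 := idem_mul c1
  have q3 : ∀ A, Q * (C * A) = 0 := fun A => by rw [← mul_assoc, hQC, zero_mul]
  have q4 : ∀ A, C * (Q * A) = 0 := fun A => by rw [← mul_assoc, hCQ, zero_mul]
  simp only [Xmap, mul_sub, sub_mul, mul_add, add_mul, mul_assoc, mul_one, one_mul, h1, c1, hQC,
    hCQ, q1, q2, q3, q4, mul_zero, zero_mul]
  abel

lemma Y_compress (h1 : Q * Q = Q) (c1 : C * C = C) (hQC : Q * C = 0) (hCQ : C * Q = 0) :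
    (1 - C) * (Ymap (Q + C) P - Ymap Q P) * (1 - C) =
      ((1 - Q - C) * P - Q * Pᴴ) * C * (Pᴴ * (1 - Q - C) - P * Q) := by
  have q1 := idem_mul h1
  have q2 := idem_mul c1
  have q3 : ∀ A, Q * (C * A) = 0 := fun A => by rw [← mul_assoc, hQC, zero_mul]
  have q4 : ∀ A, C * (Q * A) = 0 := fun A => by rw [← mul_assoc, hCQ, zero_mul]
  simp only [Ymap, mul_sub, sub_mul, mul_add, add_mul, mul_assoc, mul_one, one_mul, h1, c1, hQC,
    hCQ, q1, q2, q3, q4, mul_zero, zero_mul, smul_add, smul_sub, mul_smul_comm, smul_mul_assoc]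
  module

lemma gr_diff_rank (h1 : Q * Q = Q) (h2 : Qᴴ = Q) (c1 : C * C = C) (c2 : Cᴴ = C)
    (hQC : Q * C = 0) (hCQ : C * Q = 0) {T S : Matrix (Fin L) (Fin L) ℂ} (hS : S * T = 1) :
    (grAct T (Q + C) - grAct T Q).rank ≤ C.rank := by
  have k1 : (Q + C) * (Q + C) = Q + C := by simp [mul_add, add_mul, h1, c1, hQC, hCQ]
  have k2 : (Q + C)ᴴ = Q + C := by simp [h2, c2]
  have f0 := gr_fix h1 hS h2
  have f1 := gr_fix k1 hS k2
  have g0 := gr_herm T h2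
  have g1 := gr_herm T k2
  have f2 : grAct T (Q + C) * (T * Q) = T * Q := by
    have : T * Q = T * (Q + C) * Q := by rw [mul_assoc, add_mul, h1, hCQ, add_zero]
    rw [this, ← mul_assoc, f1]
  have f3 : grAct T (Q + C) * grAct T Q = grAct T Q := by
    conv_lhs => rhs; rw [grAct, mul_assoc (T * Q)]
    rw [← mul_assoc, f2, grAct, mul_assoc (T * Q)]
  have f4 : grAct T Q * grAct T (Q + C) = grAct T Q := by
    have := congrArg conjTranspose f3
    rwa [conjTranspose_mul, g0, g1] at this
  obtain ⟨K, hK⟩ : ∃ K, grAct T (Q + C) = T * (Q + C) * K := ⟨_, by rw [grAct, mul_assoc (T * (Q + C))]⟩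
  have e : grAct T (Q + C) - grAct T Q = ((1 - grAct T Q) * T) * C * K := by
    have : grAct T (Q + C) - grAct T Q = (1 - grAct T Q) * grAct T (Q + C) := by
      rw [sub_mul, one_mul, f4]
    rw [this, hK, ← mul_assoc (1 - grAct T Q), mul_add T, mul_add (1 - grAct T Q), sub_mul,
      one_mul, f0, sub_self, zero_add, mul_assoc (1 - grAct T Q) T C]
  rw [e]
  exact rk_mid _ _ _

end Helpers

/-- quantitative perturbative expansion of the action on the Grassmannian:
norm bounds for `X`, `Y`, `Z^{(λ)}` and rank bounds for their increments. -/
theorem statement1 (L w : ℕ) (lam : ℝ) (hlam0 : 0 < lam) (hlam : lam ≤ 1 / 2 ^ 6)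
    (P : Matrix (Fin L) (Fin L) ℂ) (hP : opNorm P ≤ 1)
    (Q : Matrix (Fin L) (Fin L) ℂ) (hQ : IsProjOfRank w Q) :
    opNorm (Xmap Q P) ≤ 1 ∧
    opNorm (Ymap Q P) ≤ 3 / 2 ∧
    opNorm (Zmap lam Q P) ≤ 20 ∧
    (∀ Q' : Matrix (Fin L) (Fin L) ℂ, Q' * Q' = Q' → Q'ᴴ = Q' → Q * Q' = 0 →
      (Xmap (Q + Q') P - Xmap Q P).rank ≤ 2 * Q'.rank ∧
      (Ymap (Q + Q') P - Ymap Q P).rank ≤ 3 * Q'.rank ∧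
      (Zmap lam (Q + Q') P - Zmap lam Q P).rank ≤ 4 * Q'.rank) := by
  obtain ⟨h1, h2, -⟩ := hQ
  rw [opNorm_eq] at hP
  have hl : lam ≤ 1 / 64 := hlam.trans (by norm_num)
  refine ⟨X_norm h1 h2 hP, Y_norm h1 h2 hP, Z_norm h1 h2 hP hlam0 hl, ?_⟩
  intro C c1 c2 hQC
  have hCQ : C * Q = 0 := by
    have := congrArg conjTranspose hQC
    rwa [conjTranspose_mul, h2, c2, conjTranspose_zero] at this
  have hX := X_compress (P := P) h1 c1 hQC hCQ
  have hY := Y_compress (P := P) h1 c1 hQC hCQ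
  refine ⟨?_, ?_, ?_⟩
  · have := rk_compress C (Xmap (Q + C) P - Xmap Q P)
    rw [hX, Matrix.rank_zero] at this
    exact this
  · have := rk_compress C (Ymap (Q + C) P - Ymap Q P)
    rw [hY] at this
    have := rk_mid ((1 - Q - C) * P - Q * Pᴴ) C (Pᴴ * (1 - Q - C) - P * Q)
    omega
  · have hST : (mexp ((lam : ℂ) • P))⁻¹ * mexp ((lam : ℂ) • P) = 1 := by
      rw [mexp_eq]
      exact Matrix.nonsing_inv_mul _ ((Matrix.isUnit_iff_isUnit_det _).1 (Matrix.isUnit_exp _))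
    have hG := gr_diff_rank h1 h2 c1 c2 hQC hCQ hST
    obtain ⟨W, hW⟩ : ∃ W, W = C + (lam : ℂ) • (Xmap (Q + C) P - Xmap Q P) +
      ((lam : ℂ) ^ 2) • (Ymap (Q + C) P - Ymap Q P) := ⟨_, rfl⟩
    have e : Zmap lam (Q + C) P - Zmap lam Q P = ((lam : ℂ) ^ 3)⁻¹ •
        ((grAct (mexp ((lam : ℂ) • P)) (Q + C) - grAct (mexp ((lam : ℂ) • P)) Q) - W) := by
      rw [hW, Zmap, Zmap, ← smul_sub]
      congr 1
      module
    have hWc : (1 - C) * W * (1 - C) = ((lam : ℂ) ^ 2) •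
        (((1 - Q - C) * P - Q * Pᴴ) * C * (Pᴴ * (1 - Q - C) - P * Q)) := by
      have hc : (1 - C) * C = 0 := by rw [sub_mul, one_mul, c1, sub_self]
      rw [hW, mul_add, mul_add, add_mul, add_mul, hc, mul_smul_comm, mul_smul_comm,
        smul_mul_assoc, smul_mul_assoc, hX, hY]
      simp
    have r1 := rk_compress C W
    rw [hWc] at r1
    have r2 := rk_smul ((lam : ℂ) ^ 2)
      (((1 - Q - C) * P - Q * Pᴴ) * C * (Pᴴ * (1 - Q - C) - P * Q))
    have r3 := rk_mid ((1 - Q - C) * P - Q * Pᴴ) C (Pᴴ * (1 - Q - C) - P * Q)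
    rw [e]
    refine (rk_smul _ _).trans ((rk_sub _ _).trans ?_)
    omega

end
end

section
/- Assume L_a ≥ 1. Then every Q ∈ 𝔾_{L,q} satisfies ‖α̂*(ℛ·Q)α̂‖ ≤ [1 − η(L_b+L_c, L_b+L_c+1)·(1 − ‖α̂*Qα̂‖)]·‖α̂*Qα̂‖. -/
open Matrix BigOperators

noncomputable section

/-- Relative gap `η(I,J) = 1 - κ_J²/κ_I²` (1-based indices). -/
def eta (κ : ℕ → ℝ) (i j : ℕ) : ℝ := 1 - κ j ^ 2 / κ i ^ 2

/-- The diagonal matrix `ℛ = diag(κ_L, …, κ_1)` (top-to-bottom entries `κ_L, …, κ_1`). -/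
def Rmat (κ : ℕ → ℝ) (L : ℕ) : Matrix (Fin L) (Fin L) ℂ :=
  Matrix.diagonal fun i : Fin L => (κ (L - (i : ℕ)) : ℂ)

/-- The frame consisting of the standard basis vectors `e_{s+1}, …, e_{s+r}`
(rows `s, …, s+r-1`). -/
def basisFrame (L r s : ℕ) : Matrix (Fin L) (Fin r) ℂ :=
  Matrix.of fun i j => if (i : ℕ) = s + (j : ℕ) then 1 else 0

def eN {n : ℕ} (x : Fin n → ℂ) : ℝ := ‖WithLp.toLp 2 x‖

lemma eN_nonneg {n : ℕ} (x : Fin n → ℂ) : 0 ≤ eN x := norm_nonneg _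

lemma eN_sq {n : ℕ} (x : Fin n → ℂ) : eN x ^ 2 = ∑ i, ‖x i‖ ^ 2 := by
  unfold eN
  rw [EuclideanSpace.norm_sq_eq]

lemma eN_sq_dot {n : ℕ} (x : Fin n → ℂ) : ((eN x ^ 2 : ℝ) : ℂ) = star x ⬝ᵥ x := by
  rw [eN_sq, dotProduct]
  push_cast
  refine Finset.sum_congr rfl fun i _ => ?_
  simp [Complex.conj_mul']

lemma dot_le {n : ℕ} (x y : Fin n → ℂ) : ‖star x ⬝ᵥ y‖ ≤ eN x * eN y := by
  have h := norm_inner_le_norm (𝕜 := ℂ) (WithLp.toLp 2 x) (WithLp.toLp 2 y)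
  rw [EuclideanSpace.inner_eq_star_dotProduct, dotProduct_comm] at h
  exact h

lemma eN_mulVec_le {m n : ℕ} (A : Matrix (Fin m) (Fin n) ℂ) (x : Fin n → ℂ) :
    eN (A *ᵥ x) ≤ opNorm A * eN x := by
  exact (LinearMap.toContinuousLinearMap (Matrix.toEuclideanLin A)).le_opNorm (WithLp.toLp 2 x)

lemma opNorm_le {m n : ℕ} (A : Matrix (Fin m) (Fin n) ℂ) (c : ℝ) (hc : 0 ≤ c)
    (h : ∀ x, eN (A *ᵥ x) ≤ c * eN x) : opNorm A ≤ c :=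
  ContinuousLinearMap.opNorm_le_bound _ hc fun x => h x.ofLp

lemma opNorm_nonneg {m n : ℕ} (A : Matrix (Fin m) (Fin n) ℂ) : 0 ≤ opNorm A := norm_nonneg _

lemma star_dot_mulVec {m n : ℕ} (A : Matrix (Fin m) (Fin n) ℂ) (x : Fin m → ℂ) (y : Fin n → ℂ) :
    star x ⬝ᵥ (A *ᵥ y) = star (Aᴴ *ᵥ x) ⬝ᵥ y := by
  rw [star_mulVec, conjTranspose_conjTranspose, dotProduct_mulVec]

/-- projections: `‖Pu‖² = ⟨u, Pu⟩`. -/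
lemma proj_sq {n : ℕ} (P : Matrix (Fin n) (Fin n) ℂ) (h1 : P * P = P) (h2 : Pᴴ = P)
    (u : Fin n → ℂ) : ((eN (P *ᵥ u) ^ 2 : ℝ) : ℂ) = star u ⬝ᵥ (P *ᵥ u) := by
  rw [eN_sq_dot, star_dot_mulVec P (P *ᵥ u), h2, mulVec_mulVec, h1]
  rw [star_dot_mulVec P u, h2]

lemma proj_le {n : ℕ} (P : Matrix (Fin n) (Fin n) ℂ) (h1 : P * P = P) (h2 : Pᴴ = P)
    (u : Fin n → ℂ) : eN (P *ᵥ u) ≤ eN u := by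
  have h := dot_le u (P *ᵥ u)
  rw [← proj_sq P h1 h2, Complex.norm_real, Real.norm_of_nonneg (sq_nonneg _)] at h
  by_contra hc
  nlinarith [eN_nonneg u, eN_nonneg (P *ᵥ u)]

lemma compr_sq {m n : ℕ} (P : Matrix (Fin n) (Fin n) ℂ) (h1 : P * P = P) (h2 : Pᴴ = P)
    (α : Matrix (Fin n) (Fin m) ℂ) (w : Fin m → ℂ) :
    eN (P *ᵥ (α *ᵥ w)) ^ 2 ≤ eN w * eN ((αᴴ * P * α) *ᵥ w) := by
  have h := dot_le w ((αᴴ * P * α) *ᵥ w)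
  have e : star w ⬝ᵥ ((αᴴ * P * α) *ᵥ w) = ((eN (P *ᵥ (α *ᵥ w)) ^ 2 : ℝ) : ℂ) := by
    rw [proj_sq P h1 h2, ← mulVec_mulVec, ← mulVec_mulVec, star_dot_mulVec αᴴ,
      conjTranspose_conjTranspose]
  rwa [e, Complex.norm_real, Real.norm_of_nonneg (sq_nonneg _)] at h

/-- vectors in the range of `P`. -/
lemma ran_le {m n : ℕ} (P : Matrix (Fin n) (Fin n) ℂ) (h1 : P * P = P) (h2 : Pᴴ = P)
    (α : Matrix (Fin n) (Fin m) ℂ) (v : Fin n → ℂ) (hv : P *ᵥ v = v) :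
    eN (αᴴ *ᵥ v) ^ 2 ≤ opNorm (αᴴ * P * α) * eN v ^ 2 := by
  set w := αᴴ *ᵥ v with hw
  have a1 : ((eN w ^ 2 : ℝ) : ℂ) = star (P *ᵥ (α *ᵥ w)) ⬝ᵥ v := by
    rw [eN_sq_dot]
    conv_lhs => rw [hw, star_dot_mulVec, conjTranspose_conjTranspose, ← hw, ← hv,
      star_dot_mulVec, h2]
  have a2 := dot_le (P *ᵥ (α *ᵥ w)) v
  rw [← a1, Complex.norm_real, Real.norm_of_nonneg (sq_nonneg _)] at a2
  have a3 := compr_sq P h1 h2 α w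
  have a4 := eN_mulVec_le (αᴴ * P * α) w
  have n0 := opNorm_nonneg (αᴴ * P * α)
  generalize opNorm (αᴴ * P * α) = N at *
  generalize eN ((αᴴ * P * α) *ᵥ w) = b at *
  have p1 := eN_nonneg w
  have p2 := eN_nonneg v
  have p3 := eN_nonneg (P *ᵥ (α *ᵥ w))
  generalize eN (P *ᵥ (α *ᵥ w)) = d at *
  generalize eN w = x at *
  generalize eN v = y at *
  have a5 : d ^ 2 ≤ N * x ^ 2 := by nlinarith
  rcases p1.eq_or_lt with h | h
  · rw [← h, zero_pow two_ne_zero]; positivity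
  · have : (x ^ 2) ^ 2 ≤ (d * y) ^ 2 := pow_le_pow_left₀ (by positivity) a2 2
    have h3 : x ^ 2 * x ^ 2 ≤ x ^ 2 * (N * y ^ 2) := by
      nlinarith [mul_le_mul_of_nonneg_right a5 (sq_nonneg y)]
    exact le_of_mul_le_mul_left h3 (by positivity)

lemma grAct_facts {L : ℕ} (T Q : Matrix (Fin L) (Fin L) ℂ) (h1 : Q * Q = Q) (h2 : Qᴴ = Q) :
    grAct T Q * grAct T Q = grAct T Q ∧ (grAct T Q)ᴴ = grAct T Q := by
  unfold grAct
  set A := Q * Tᴴ * T * Q + (1 - Q) with hA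
  have hAH : Aᴴ = A := by
    simp [hA, conjTranspose_mul, h2, Matrix.mul_assoc]
  have hAQ : A * Q = Q * Tᴴ * T * Q := by
    simp [hA, Matrix.add_mul, Matrix.sub_mul, Matrix.mul_assoc, h1]
  constructor
  · by_cases hu : IsUnit A.det
    · calc T * Q * A⁻¹ * (Q * Tᴴ) * (T * Q * A⁻¹ * (Q * Tᴴ))
          = T * Q * A⁻¹ * (Q * Tᴴ * T * Q) * A⁻¹ * (Q * Tᴴ) := by
            simp only [Matrix.mul_assoc]
        _ = T * Q * (A⁻¹ * A) * Q * A⁻¹ * (Q * Tᴴ) := by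
            rw [← hAQ]; simp only [Matrix.mul_assoc]
        _ = T * (Q * Q) * A⁻¹ * (Q * Tᴴ) := by
            rw [Matrix.nonsing_inv_mul _ hu]; simp only [Matrix.mul_assoc, Matrix.one_mul]
        _ = _ := by rw [h1]
    · rw [Matrix.nonsing_inv_apply_not_isUnit _ hu]; simp
  · simp only [conjTranspose_mul, conjTranspose_nonsing_inv, hAH, h2, conjTranspose_conjTranspose,
      Matrix.mul_assoc]

lemma core {L m : ℕ} (T Q : Matrix (Fin L) (Fin L) ℂ) (h1 : Q * Q = Q) (h2 : Qᴴ = Q)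
    (α : Matrix (Fin L) (Fin m) ℂ) (c : ℝ) (hc : 0 ≤ c)
    (H : ∀ v, Q *ᵥ v = v → eN (αᴴ *ᵥ (T *ᵥ v)) ^ 2 ≤ c * eN (T *ᵥ v) ^ 2) :
    opNorm (αᴴ * grAct T Q * α) ≤ c := by
  obtain ⟨g1, g2⟩ := grAct_facts T Q h1 h2
  refine opNorm_le _ c hc fun w => ?_
  have a1 := compr_sq (grAct T Q) g1 g2 α w
  obtain ⟨v, hv, hGv⟩ : ∃ v, Q *ᵥ v = v ∧ grAct T Q *ᵥ (α *ᵥ w) = T *ᵥ v := by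
    refine ⟨(Q * (Q * Tᴴ * T * Q + (1 - Q))⁻¹ * (Q * Tᴴ)) *ᵥ (α *ᵥ w), ?_, ?_⟩
    · rw [mulVec_mulVec, Matrix.mul_assoc Q, ← Matrix.mul_assoc Q Q, h1]
    · rw [grAct]; simp only [mulVec_mulVec, Matrix.mul_assoc]
  have a2 := H v hv
  rw [← hGv] at a2
  have e : (αᴴ * grAct T Q * α) *ᵥ w = αᴴ *ᵥ (grAct T Q *ᵥ (α *ᵥ w)) := by
    simp only [mulVec_mulVec, Matrix.mul_assoc]
  rw [← e] at a2
  have p1 := eN_nonneg w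
  have p2 := eN_nonneg ((αᴴ * grAct T Q * α) *ᵥ w)
  generalize eN ((αᴴ * grAct T Q * α) *ᵥ w) = b at *
  generalize eN w = x at *
  generalize eN (grAct T Q *ᵥ (α *ᵥ w)) = d at *
  rcases p2.eq_or_lt with h | h
  · rw [← h]; positivity
  · have : b * b ≤ b * (c * x) := by nlinarith [mul_le_mul_of_nonneg_left a1 hc]
    exact le_of_mul_le_mul_left this h

lemma frame_apply {La M : ℕ} (x : Fin (La + M) → ℂ) (j : Fin La) :
    ((basisFrame (La + M) La 0)ᴴ *ᵥ x) j = x (Fin.castAdd M j) := by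
  rw [mulVec, dotProduct, Finset.sum_eq_single (Fin.castAdd M j)]
  · simp [basisFrame]
  · intro b _ hb
    have : ¬ ((b : ℕ) = (j : ℕ)) := fun h => hb (Fin.ext (by simpa using h))
    simp [basisFrame, this]
  · simp

lemma frame_gram {La M : ℕ} : 
    (basisFrame (La + M) La 0)ᴴ * basisFrame (La + M) La 0 = 1 := by
  ext i j
  have := frame_apply (M := M) (fun k => basisFrame (La + M) La 0 k j) i
  rw [mulVec, dotProduct] at this
  rw [Matrix.mul_apply, this]
  simp [basisFrame, Matrix.one_apply, Fin.ext_iff]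

lemma frame_eN {La M : ℕ} (w : Fin La → ℂ) :
    eN (basisFrame (La + M) La 0 *ᵥ w) = eN w := by
  have : ((eN (basisFrame (La + M) La 0 *ᵥ w) ^ 2 : ℝ) : ℂ) = ((eN w ^ 2 : ℝ) : ℂ) := by
    rw [eN_sq_dot, eN_sq_dot, star_dot_mulVec, mulVec_mulVec, frame_gram, one_mulVec]
  have h := Complex.ofReal_injective this
  exact (sq_eq_sq₀ (eN_nonneg _) (eN_nonneg _)).1 h

lemma frame_sq {La M : ℕ} (x : Fin (La + M) → ℂ) :
    eN ((basisFrame (La + M) La 0)ᴴ *ᵥ x) ^ 2 = ∑ j, ‖x (Fin.castAdd M j)‖ ^ 2 := by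
  rw [eN_sq]; simp only [frame_apply]

lemma frame_split {La M : ℕ} (x : Fin (La + M) → ℂ) :
    eN x ^ 2 = eN ((basisFrame (La + M) La 0)ᴴ *ᵥ x) ^ 2 + ∑ j, ‖x (Fin.natAdd La j)‖ ^ 2 := by
  rw [frame_sq, eN_sq, Fin.sum_univ_add]

lemma compr_le_one {La M : ℕ} (Q : Matrix (Fin (La + M)) (Fin (La + M)) ℂ) (h1 : Q * Q = Q)
    (h2 : Qᴴ = Q) :
    opNorm ((basisFrame (La + M) La 0)ᴴ * Q * basisFrame (La + M) La 0) ≤ 1 := by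
  refine opNorm_le _ 1 zero_le_one fun w => ?_
  rw [one_mul, ← mulVec_mulVec, ← mulVec_mulVec]
  have a := frame_split (Q *ᵥ (basisFrame (La + M) La 0 *ᵥ w))
  have b := proj_le Q h1 h2 (basisFrame (La + M) La 0 *ᵥ w)
  rw [frame_eN] at b
  have c : 0 ≤ ∑ j, ‖(Q *ᵥ (basisFrame (La + M) La 0 *ᵥ w)) (Fin.natAdd La j)‖ ^ 2 := by positivity
  refine le_trans ?_ b
  exact (sq_le_sq₀ (eN_nonneg _) (eN_nonneg _)).1 (by linarith)

/-- scalar inequality -/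
lemma scalar_ineq (A B n x y X Y : ℝ) (hA : 0 < A) (hAB : A ≤ B) (n0 : 0 ≤ n) (n1 : n ≤ 1)
    (x0 : 0 ≤ x) (y0 : 0 ≤ y) (hX0 : 0 ≤ X) (hn : x ≤ n * (x + y)) (hX : X ≤ A * x)
    (hY : B * y ≤ Y) :
    X ≤ ((1 - (1 - A / B) * (1 - n)) * n) * (X + Y) := by
  have hB : 0 < B := hA.trans_le hAB
  obtain ⟨r, hr⟩ : ∃ r, r = A / B := ⟨_, rfl⟩
  have hAr : A = r * B := by rw [hr]; field_simp
  have r0 : 0 < r := by rw [hr]; positivity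
  have r1 : r ≤ 1 := by rw [hr]; exact (div_le_one hB).2 hAB
  rw [← hr]
  set c := (1 - (1 - r) * (1 - n)) * n with hc
  have c0 : 0 ≤ c := mul_nonneg (by nlinarith) n0
  have c1 : c ≤ 1 := by nlinarith [mul_nonneg (sub_nonneg.2 r1) (sub_nonneg.2 n1)]
  have key : r * x * (1 - c) ≤ c * y := by
    have h1 : x * (1 - n) ≤ n * y := by linarith
    have h2 : r * (1 - c) * n ≤ c * (1 - n) := by
      have : c * (1 - n) - r * (1 - c) * n = n * ((1 - r) ^ 2 * (n * (1 - n))) := by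
        rw [hc]; ring
      have h3 : 0 ≤ n * (1 - n) := mul_nonneg n0 (by linarith)
      have h4 := mul_nonneg n0 (mul_nonneg (sq_nonneg (1 - r)) h3)
      linarith
    rcases n0.eq_or_lt with h | h
    · have hx : x = 0 := by rw [← h] at hn; linarith
      rw [hx]; simp only [mul_zero, zero_mul]; positivity
    · rcases n1.eq_or_lt with h' | h'
      · have : c = 1 := by rw [hc, h']; ring
        rw [this]; linarith
      · have h5 : n * (r * x * (1 - c)) ≤ n * (c * y) := by
          nlinarith [mul_le_mul_of_nonneg_left h1 c0, mul_le_mul_of_nonneg_left h2 x0]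
        exact le_of_mul_le_mul_left h5 h
  rw [hAr] at hX
  clear_value c
  nlinarith [mul_le_mul_of_nonneg_right hX (sub_nonneg.2 c1), mul_le_mul_of_nonneg_left hY c0,
    mul_le_mul_of_nonneg_left key hB.le]

/-- norm contraction by the hyperbolic action, microscopic gap:
`‖α̂*(ℛ·Q)α̂‖ ≤ [1 − η(L_b+L_c, L_b+L_c+1)(1 − ‖α̂*Qα̂‖)]·‖α̂*Qα̂‖`,
where `α̂` is the frame of the first `L_a` standard basis vectors. -/
theorem statement3 (L La Lb Lc q : ℕ) (hL : L = La + Lb + Lc) (hLa : 1 ≤ La)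
    (κ : ℕ → ℝ)
    (hκpos : ∀ i, 1 ≤ i → i ≤ L → 0 < κ i)
    (hκmono : ∀ i j, 1 ≤ i → i ≤ j → j ≤ L → κ j ≤ κ i)
    (Q : Matrix (Fin L) (Fin L) ℂ) (hQ : IsProjOfRank q Q) :
    opNorm ((basisFrame L La 0)ᴴ * grAct (Rmat κ L) Q * basisFrame L La 0) ≤
      (1 - eta κ (Lb + Lc) (Lb + Lc + 1)
          * (1 - opNorm ((basisFrame L La 0)ᴴ * Q * basisFrame L La 0)))
        * opNorm ((basisFrame L La 0)ᴴ * Q * basisFrame L La 0) := by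
  obtain ⟨h1, h2, -⟩ := hQ
  rw [Nat.add_assoc] at hL
  generalize Lb + Lc = M at *
  subst hL
  set n := opNorm ((basisFrame (La + M) La 0)ᴴ * Q * basisFrame (La + M) La 0) with hn
  have n0 : 0 ≤ n := opNorm_nonneg _
  have n1 : n ≤ 1 := compr_le_one Q h1 h2
  have hran := ran_le Q h1 h2 (basisFrame (La + M) La 0)
  rw [← hn] at hran
  rcases Nat.eq_zero_or_pos M with hM | hM
  · subst hM
    have hfull : ∀ x : Fin (La + 0) → ℂ, eN ((basisFrame (La + 0) La 0)ᴴ *ᵥ x) ^ 2 = eN x ^ 2 := by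
      intro x
      rw [frame_split x]; simp
    by_cases hv : ∃ v, Q *ᵥ v = v ∧ eN v ≠ 0
    · obtain ⟨v, hv, hv0⟩ := hv
      have h := hran v hv
      rw [hfull] at h
      have : 0 < eN v ^ 2 := by positivity
      have hn1 : n = 1 := le_antisymm n1 (by by_contra hc; push Not at hc; nlinarith)
      rw [hn1]
      simp only [sub_self, mul_zero, sub_zero, mul_one]
      exact core _ Q h1 h2 _ 1 zero_le_one fun v _ => by rw [hfull, one_mul]
    · push Not at hv
      have hQ0 : Q = 0 := by
        apply Matrix.ext_of_mulVec_single
        intro i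
        have h := hv (Q *ᵥ Pi.single i 1) (by rw [mulVec_mulVec, h1])
        have h' : WithLp.toLp 2 (Q *ᵥ Pi.single i 1) = 0 := norm_eq_zero.1 h
        rw [Matrix.zero_mulVec]
        exact congrArg WithLp.ofLp h'
      have z : opNorm (0 : Matrix (Fin La) (Fin La) ℂ) = 0 := by simp [opNorm]
      have hn0 : n = 0 := by rw [hn, hQ0]; simp [z]
      rw [hn0, hQ0, grAct]
      simp [z]
  · have hb := hκpos M hM (by omega)
    have ha := hκpos (M + 1) (by omega) (by omega)
    have hab := hκmono M (M + 1) hM (by omega) (by omega)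
    have r1 : κ (M + 1) ^ 2 ≤ κ M ^ 2 := pow_le_pow_left₀ ha.le hab 2
    have e0 : 0 ≤ κ (M + 1) ^ 2 / κ M ^ 2 := by positivity
    unfold eta
    refine core _ Q h1 h2 _ _ (mul_nonneg (by nlinarith) n0) fun v hv => ?_
    have h := hran v hv
    have hs := frame_split v
    have hT := frame_split (Rmat κ (La + M) *ᵥ v)
    have hcomp : ∀ i, ‖(Rmat κ (La + M) *ᵥ v) i‖ ^ 2 = κ (La + M - i) ^ 2 * ‖v i‖ ^ 2 := by
      intro i
      rw [Rmat, mulVec_diagonal, norm_mul, Complex.norm_real, mul_pow, Real.norm_eq_abs, sq_abs]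
    rw [hT]
    refine scalar_ineq _ _ _ (eN ((basisFrame (La + M) La 0)ᴴ *ᵥ v) ^ 2)
      (∑ j, ‖v (Fin.natAdd La j)‖ ^ 2) _ _ (by positivity) r1 n0 n1 (by positivity)
      (by positivity) (by positivity) (by rw [← hs]; exact h) ?_ ?_
    · rw [frame_sq, frame_sq, Finset.mul_sum]
      refine Finset.sum_le_sum fun j _ => ?_
      rw [hcomp, Fin.val_castAdd]
      have hj := j.2
      refine mul_le_mul_of_nonneg_right (pow_le_pow_left₀ ?_ ?_ 2) (by positivity)
      · exact (hκpos _ (by omega) (by omega)).le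
      · exact hκmono _ _ (by omega) (by omega) (by omega)
    · rw [Finset.mul_sum]
      refine Finset.sum_le_sum fun j _ => ?_
      rw [hcomp, Fin.val_natAdd]
      have hj := j.2
      refine mul_le_mul_of_nonneg_right (pow_le_pow_left₀ hb.le ?_ 2) (by positivity)
      exact hκmono _ _ (by omega) (by omega) (by omega)

end
end

section
/- Every Q ∈ 𝔾_{L,q} satisfies the two inequalities tr[α̂*(ℛ·Q)α̂] ≤ tr[α̂*Q(1_L − 𝜼·γ̂γ̂*)Qα̂] and tr[γ̂*(ℛ·Q)γ̂] ≥ tr[γ̂*Q(1_L + 𝜼·α̂α̂*)Qγ̂], where 𝜼 := η(L_c, L_b+L_c). -/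
open Matrix BigOperators

noncomputable section

section helperLemmas

open scoped ComplexOrder

/-- Compression `Q diag(f) Q` of a real diagonal matrix. -/
def cmpr {L : ℕ} (Q : Matrix (Fin L) (Fin L) ℂ) (f : Fin L → ℝ) : Matrix (Fin L) (Fin L) ℂ :=
  Q * Matrix.diagonal (fun i => (f i : ℂ)) * Q

/-- `Q diag(f) Q + (1 - Q)`. -/
def cmprM {L : ℕ} (Q : Matrix (Fin L) (Fin L) ℂ) (f : Fin L → ℝ) : Matrix (Fin L) (Fin L) ℂ :=
  cmpr Q f + (1 - Q)

lemma cmpr_add {L : ℕ} (Q : Matrix (Fin L) (Fin L) ℂ) (f g : Fin L → ℝ) :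
    cmpr Q (f + g) = cmpr Q f + cmpr Q g := by
  have : (Matrix.diagonal (fun i => ((f + g) i : ℂ)) : Matrix (Fin L) (Fin L) ℂ) =
      Matrix.diagonal (fun i => (f i : ℂ)) + Matrix.diagonal (fun i => (g i : ℂ)) := by
    rw [Matrix.diagonal_add]; simp
  simp only [cmpr, this, Matrix.mul_add, Matrix.add_mul]

lemma cmpr_smul {L : ℕ} (Q : Matrix (Fin L) (Fin L) ℂ) (c : ℝ) (f : Fin L → ℝ) :
    cmpr Q (c • f) = (c : ℂ) • cmpr Q f := by
  have : (Matrix.diagonal (fun i => ((c • f) i : ℂ)) : Matrix (Fin L) (Fin L) ℂ) =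
      (c : ℂ) • Matrix.diagonal (fun i => (f i : ℂ)) := by
    rw [← Matrix.diagonal_smul]; congr 1; ext i; simp
  simp only [cmpr, this, Matrix.mul_smul, Matrix.smul_mul]

lemma cmpr_one {L : ℕ} (Q : Matrix (Fin L) (Fin L) ℂ) (h : Q * Q = Q) :
    cmpr Q 1 = Q := by
  simp [cmpr, h]

lemma cmpr_psd {L : ℕ} (Q : Matrix (Fin L) (Fin L) ℂ) (h : Qᴴ = Q) (f : Fin L → ℝ)
    (hf : ∀ i, 0 ≤ f i) : (cmpr Q f).PosSemidef := by
  have h1 : (Matrix.diagonal (fun i => (f i : ℂ)) : Matrix (Fin L) (Fin L) ℂ).PosSemidef :=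
    Matrix.PosSemidef.diagonal (fun i => by simpa using hf i)
  have := h1.mul_mul_conjTranspose_same Q
  rwa [h] at this

lemma cmpr_sub_psd {L : ℕ} (Q : Matrix (Fin L) (Fin L) ℂ) (h : Qᴴ = Q) (f g : Fin L → ℝ)
    (hf : ∀ i, f i ≤ g i) : (cmpr Q g - cmpr Q f).PosSemidef := by
  have : cmpr Q g = cmpr Q f + cmpr Q (g - f) := by rw [← cmpr_add]; congr 1; abel
  rw [this, add_sub_cancel_left]
  exact cmpr_psd Q h _ (fun i => by simpa using hf i)

lemma one_sub_psd {L : ℕ} (Q : Matrix (Fin L) (Fin L) ℂ) (h2 : Q * Q = Q) (h : Qᴴ = Q) :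
    (1 - Q).PosSemidef := by
  have := Matrix.posSemidef_conjTranspose_mul_self (1 - Q)
  have e : (1 - Q)ᴴ * (1 - Q) = 1 - Q := by
    rw [Matrix.conjTranspose_sub, Matrix.conjTranspose_one, h, Matrix.sub_mul, Matrix.mul_sub, Matrix.mul_sub, h2]
    simp
  rwa [e] at this

lemma cmprM_posDef {L : ℕ} (Q : Matrix (Fin L) (Fin L) ℂ) (h2 : Q * Q = Q) (h : Qᴴ = Q)
    (f : Fin L → ℝ) (hf : ∀ i, 0 < f i) : (cmprM Q f).PosDef := by
  obtain ⟨c, hc, hcf⟩ : ∃ c : ℝ, 0 < c ∧ ∀ i, c ≤ f i := by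
    rcases isEmpty_or_nonempty (Fin L) with hE | hE
    · exact ⟨1, one_pos, fun i => hE.elim i⟩
    · obtain ⟨i, hi⟩ := Finite.exists_min f
      exact ⟨f i, hf i, hi⟩
  set m := min c 1 with hm
  have hm0 : 0 < m := lt_min hc one_pos
  have e : cmprM Q f = (m : ℂ) • (1 : Matrix (Fin L) (Fin L) ℂ) +
      ((cmpr Q f - cmpr Q (m • 1)) + ((1 - m : ℝ) : ℂ) • (1 - Q)) := by
    rw [cmpr_smul, cmpr_one Q h2, cmprM]
    push_cast
    module
  rw [e]
  refine Matrix.PosDef.add_posSemidef ?_ (Matrix.PosSemidef.add ?_ ?_)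
  · exact Matrix.PosDef.one.smul (by exact_mod_cast hm0)
  · exact cmpr_sub_psd Q h _ _ (fun i => by
      simpa only [Pi.smul_apply, Pi.one_apply, smul_eq_mul, mul_one] using
        (min_le_left c 1).trans (hcf i))
  · exact (one_sub_psd Q h2 h).smul (by
      have : 0 ≤ 1 - m := sub_nonneg.2 (min_le_right _ _)
      exact_mod_cast this)

lemma psd_trace_mul {L : ℕ} {A B : Matrix (Fin L) (Fin L) ℂ} (hA : A.PosSemidef)
    (hB : B.PosSemidef) : 0 ≤ (A * B).trace.re := by
  obtain ⟨C, rfl⟩ : ∃ C, B = C * Cᴴ := by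
    open scoped MatrixOrder in
    obtain ⟨C, hC⟩ := CStarAlgebra.nonneg_iff_eq_mul_star_self.1 hB.nonneg
    exact ⟨C, hC⟩
  have := (hA.conjTranspose_mul_mul_same C).trace_nonneg
  rw [← Matrix.mul_assoc, Matrix.trace_mul_comm, ← Matrix.mul_assoc]
  exact (Complex.le_def.1 this).1

lemma psd_mul_commute {L : ℕ} {A B : Matrix (Fin L) (Fin L) ℂ} (hA : A.PosSemidef)
    (hB : B.PosSemidef) (h : A * B = B * A) : (A * B).PosSemidef := by
  open scoped MatrixOrder in
  exact (Commute.mul_nonneg hA.nonneg hB.nonneg h).posSemidef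

lemma inv_sub_inv_psd {L : ℕ} {A B : Matrix (Fin L) (Fin L) ℂ} (hA : A.PosDef)
    (hB : B.PosDef) (h : (B - A).PosSemidef) : (A⁻¹ - B⁻¹).PosSemidef := by
  have a1 : A⁻¹ * A = 1 := Matrix.nonsing_inv_mul _ ((Matrix.isUnit_iff_isUnit_det _).1 hA.isUnit)
  have a2 : A * A⁻¹ = 1 := Matrix.mul_nonsing_inv _ ((Matrix.isUnit_iff_isUnit_det _).1 hA.isUnit)
  have b1 : B⁻¹ * B = 1 := Matrix.nonsing_inv_mul _ ((Matrix.isUnit_iff_isUnit_det _).1 hB.isUnit)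
  have e : A⁻¹ - B⁻¹ = (A⁻¹ - B⁻¹) * A * (A⁻¹ - B⁻¹)ᴴ + B⁻¹ * (B - A) * (B⁻¹)ᴴ := by
    rw [Matrix.conjTranspose_sub, hA.inv.isHermitian.eq, hB.inv.isHermitian.eq]
    simp only [Matrix.sub_mul, Matrix.mul_sub, a1, b1, Matrix.mul_assoc, a2, Matrix.one_mul,
      Matrix.mul_one]
    abel
  rw [e]
  exact (hA.posSemidef.mul_mul_conjTranspose_same _).add (h.mul_mul_conjTranspose_same _)

/-- Monotonicity of `tr[(Q(x+y)Q + 1 - Q)⁻¹ QxQ]`. -/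
lemma mono_tr {L : ℕ} (Q : Matrix (Fin L) (Fin L) ℂ) (h2 : Q * Q = Q) (h : Qᴴ = Q)
    (x x' y y' : Fin L → ℝ) (hx : ∀ i, 0 ≤ x i) (hy' : ∀ i, 0 ≤ y' i)
    (hxx : ∀ i, x i ≤ x' i) (hyy : ∀ i, y' i ≤ y i) (hp : ∀ i, 0 < x i + y' i) :
    ((cmprM Q (x + y))⁻¹ * cmpr Q x).trace.re ≤ ((cmprM Q (x' + y'))⁻¹ * cmpr Q x').trace.re := by
  have p0 := cmprM_posDef Q h2 h (x + y') hp
  have p1 := cmprM_posDef Q h2 h (x + y) (fun i => by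
    simp only [Pi.add_apply]; linarith [hp i, hyy i])
  have p2 := cmprM_posDef Q h2 h (x' + y') (fun i => by
    simp only [Pi.add_apply]; linarith [hp i, hxx i])
  have key : ∀ z : Fin L → ℝ, (cmprM Q (z + y')).PosDef →
      ((cmprM Q (z + y'))⁻¹ * cmpr Q z).trace.re =
        (1 : Matrix (Fin L) (Fin L) ℂ).trace.re -
          ((cmprM Q (z + y'))⁻¹ * (cmpr Q y' + (1 - Q))).trace.re := by
    intro z hz
    have := Matrix.nonsing_inv_mul _ ((Matrix.isUnit_iff_isUnit_det _).1 hz.isUnit)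
    rw [← this, ← Complex.sub_re, ← Matrix.trace_sub, ← Matrix.mul_sub]
    have e : cmprM Q (z + y') - (cmpr Q y' + (1 - Q)) = cmpr Q z := by
      rw [cmprM, cmpr_add]; abel
    rw [this, e]
  have s1 : ((cmprM Q (x + y))⁻¹ * cmpr Q x).trace.re ≤
      ((cmprM Q (x + y'))⁻¹ * cmpr Q x).trace.re := by
    have := psd_trace_mul (inv_sub_inv_psd p0 p1 (by
      have := cmpr_sub_psd Q h (x + y') (x + y) (fun i => by simpa using hyy i)
      simpa [cmprM] using this)) (cmpr_psd Q h x hx)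
    rw [Matrix.sub_mul, Matrix.trace_sub, Complex.sub_re] at this
    linarith
  have s2 : ((cmprM Q (x + y'))⁻¹ * cmpr Q x).trace.re ≤
      ((cmprM Q (x' + y'))⁻¹ * cmpr Q x').trace.re := by
    rw [key x p0, key x' p2]
    have := psd_trace_mul (inv_sub_inv_psd p0 p2 (by
      have := cmpr_sub_psd Q h (x + y') (x' + y') (fun i => by simpa using hxx i)
      simpa [cmprM] using this)) ((cmpr_psd Q h y' hy').add (one_sub_psd Q h2 h))
    rw [Matrix.sub_mul, Matrix.trace_sub, Complex.sub_re] at this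
    linarith
  exact s1.trans s2

lemma Q_cmpr {L : ℕ} (Q : Matrix (Fin L) (Fin L) ℂ) (h2 : Q * Q = Q) (f : Fin L → ℝ) :
    Q * cmpr Q f = cmpr Q f := by
  simp only [cmpr, ← Matrix.mul_assoc, h2]

lemma cmpr_Q {L : ℕ} (Q : Matrix (Fin L) (Fin L) ℂ) (h2 : Q * Q = Q) (f : Fin L → ℝ) :
    cmpr Q f * Q = cmpr Q f := by
  simp only [cmpr, Matrix.mul_assoc, h2]

/-- First scalar-calculus step. -/
lemma step_first {L : ℕ} (Q : Matrix (Fin L) (Fin L) ℂ) (h2 : Q * Q = Q) (h : Qᴴ = Q)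
    (a c : Fin L → ℝ) (ha : ∀ i, 0 ≤ a i) (hc : ∀ i, 0 ≤ c i) (hc1 : ∀ i, c i ≤ 1)
    (s t : ℝ) (hs : 0 < s) (hst : s ≤ t) :
    ((cmprM Q (s • 1 + (t - s) • c))⁻¹ * cmpr Q (s • a)).trace.re ≤
      ((Q - ((1 - s / t : ℝ) : ℂ) • cmpr Q c) * cmpr Q a).trace.re := by
  have ht : 0 < t := hs.trans_le hst
  set η : ℝ := 1 - s / t with hη
  have hηt : t - s = η * t := by rw [hη]; field_simp
  have hst' : (s : ℂ) = t - η * t := by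
    have : s = t - η * t := by linarith
    exact_mod_cast this
  set M := cmprM Q (s • 1 + (t - s) • c) with hM
  set C := cmpr Q c with hC
  set A := cmpr Q a with hA
  have hMe : M = (s : ℂ) • Q + ((η * t : ℝ) : ℂ) • C + (1 - Q) := by
    rw [hM, cmprM, cmpr_add, cmpr_smul, cmpr_smul, cmpr_one Q h2, hηt]
  have pM : M.PosDef := cmprM_posDef Q h2 h _ (fun i => by
    simp only [Pi.add_apply, Pi.smul_apply, Pi.one_apply, smul_eq_mul, mul_one]
    have := mul_nonneg (sub_nonneg.2 hst) (hc i)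
    linarith)
  have m1 : M⁻¹ * M = 1 := Matrix.nonsing_inv_mul _ ((Matrix.isUnit_iff_isUnit_det _).1 pM.isUnit)
  have m2 : M * M⁻¹ = 1 := Matrix.mul_nonsing_inv _ ((Matrix.isUnit_iff_isUnit_det _).1 pM.isUnit)
  have qC : Q * C = C := Q_cmpr Q h2 c
  have Cq : C * Q = C := cmpr_Q Q h2 c
  have qA : Q * A = A := Q_cmpr Q h2 a
  have pC : C.PosSemidef := cmpr_psd Q h c hc
  have pCC : (C - C * C).PosSemidef := by
    have p1 : (Q - C).PosSemidef := by
      have := cmpr_sub_psd Q h c 1 hc1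
      rwa [cmpr_one Q h2] at this
    have := psd_mul_commute pC p1 (by rw [Matrix.mul_sub, Matrix.sub_mul, qC, Cq])
    rwa [Matrix.mul_sub, Cq] at this
  have hMC : M * (C - C * C) = (C - C * C) * M := by
    rw [hMe]
    simp only [Matrix.mul_sub, Matrix.sub_mul, Matrix.mul_add, Matrix.add_mul, Matrix.smul_mul,
      Matrix.mul_smul, qC, Cq, ← Matrix.mul_assoc, Matrix.one_mul, Matrix.mul_one]
    simp only [Matrix.mul_assoc, Cq]
    module
  have hMC' : M⁻¹ * (C - C * C) = (C - C * C) * M⁻¹ := by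
    calc M⁻¹ * (C - C * C) = M⁻¹ * ((C - C * C) * M) * M⁻¹ := by
          simp only [Matrix.mul_assoc, m2, Matrix.mul_one]
      _ = _ := by rw [← hMC]; simp only [← Matrix.mul_assoc, m1, Matrix.one_mul]
  have main := psd_trace_mul (psd_mul_commute pM.inv.posSemidef pCC hMC') (cmpr_psd Q h a ha)
  have e1 : M * (Q - (η : ℂ) • C) = (s : ℂ) • Q + ((η ^ 2 * t : ℝ) : ℂ) • (C - C * C) := by
    rw [hMe, hst']
    simp only [Matrix.mul_sub, Matrix.sub_mul, Matrix.add_mul, Matrix.smul_mul,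
      Matrix.mul_smul, qC, Cq, h2, Matrix.one_mul]
    push_cast
    module
  have e2 : (Q - (η : ℂ) • C) * A - M⁻¹ * cmpr Q (s • a) =
      ((η ^ 2 * t : ℝ) : ℂ) • (M⁻¹ * (C - C * C) * A) := by
    have : Q - (η : ℂ) • C = M⁻¹ * ((s : ℂ) • Q + ((η ^ 2 * t : ℝ) : ℂ) • (C - C * C)) := by
      rw [← e1, ← Matrix.mul_assoc, m1, Matrix.one_mul]
    rw [this, cmpr_smul, ← hA]
    simp only [Matrix.mul_add, Matrix.add_mul, Matrix.mul_smul, Matrix.smul_mul]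
    rw [Matrix.mul_assoc M⁻¹ Q A, qA]
    abel
  have e3 := congrArg (fun X => (Matrix.trace X).re) e2
  simp only [Matrix.trace_sub, Matrix.trace_smul, Complex.sub_re, smul_eq_mul,
    Complex.re_ofReal_mul] at e3
  have : 0 ≤ η ^ 2 * t * (M⁻¹ * (C - C * C) * A).trace.re :=
    mul_nonneg (by positivity) main
  linarith

/-- Second scalar-calculus step. -/
lemma step_second {L : ℕ} (Q : Matrix (Fin L) (Fin L) ℂ) (h2 : Q * Q = Q) (h : Qᴴ = Q)
    (a c : Fin L → ℝ) (ha : ∀ i, 0 ≤ a i) (hc : ∀ i, 0 ≤ c i) (ha1 : ∀ i, a i ≤ 1)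
    (s t : ℝ) (hs : 0 < s) (hst : s ≤ t) :
    ((Q + ((1 - s / t : ℝ) : ℂ) • cmpr Q a) * cmpr Q c).trace.re ≤
    ((cmprM Q (t • 1 + (s - t) • a))⁻¹ * cmpr Q (t • c)).trace.re := by
  have ht : 0 < t := hs.trans_le hst
  set η : ℝ := 1 - s / t with hη
  have hηt : s - t = - (η * t) := by rw [hη]; field_simp; ring
  set M := cmprM Q (t • 1 + (s - t) • a) with hM
  set C := cmpr Q c with hC
  set A := cmpr Q a with hA
  have hMe : M = (t : ℂ) • Q + ((-(η * t) : ℝ) : ℂ) • A + (1 - Q) := by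
    rw [hM, cmprM, cmpr_add, cmpr_smul, cmpr_smul, cmpr_one Q h2, hηt]
  have pM : M.PosDef := cmprM_posDef Q h2 h _ (fun i => by
    simp only [Pi.add_apply, Pi.smul_apply, Pi.one_apply, smul_eq_mul, mul_one]
    have := mul_nonneg (sub_nonneg.2 hst) (sub_nonneg.2 (ha1 i))
    linarith)
  have m1 : M⁻¹ * M = 1 := Matrix.nonsing_inv_mul _ ((Matrix.isUnit_iff_isUnit_det _).1 pM.isUnit)
  have m2 : M * M⁻¹ = 1 := Matrix.mul_nonsing_inv _ ((Matrix.isUnit_iff_isUnit_det _).1 pM.isUnit)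
  have qC : Q * C = C := Q_cmpr Q h2 c
  have qA : Q * A = A := Q_cmpr Q h2 a
  have Aq : A * Q = A := cmpr_Q Q h2 a
  have pA : A.PosSemidef := cmpr_psd Q h a ha
  have pAA : (A * A).PosSemidef := psd_mul_commute pA pA rfl
  have hMA : M * (A * A) = (A * A) * M := by
    rw [hMe]
    simp only [Matrix.mul_sub, Matrix.sub_mul, Matrix.mul_add, Matrix.add_mul, Matrix.smul_mul,
      Matrix.mul_smul, qA, Aq, ← Matrix.mul_assoc, Matrix.one_mul, Matrix.mul_one]
    simp only [Matrix.mul_assoc, Aq]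
  have hMA' : M⁻¹ * (A * A) = (A * A) * M⁻¹ := by
    calc M⁻¹ * (A * A) = M⁻¹ * ((A * A) * M) * M⁻¹ := by
          simp only [Matrix.mul_assoc, m2, Matrix.mul_one]
      _ = _ := by rw [← hMA]; simp only [← Matrix.mul_assoc, m1, Matrix.one_mul]
  have main := psd_trace_mul (psd_mul_commute pM.inv.posSemidef pAA hMA') (cmpr_psd Q h c hc)
  have e1 : M * (Q + (η : ℂ) • A) = (t : ℂ) • Q - ((η ^ 2 * t : ℝ) : ℂ) • (A * A) := by
    rw [hMe]
    simp only [Matrix.mul_add, Matrix.sub_mul, Matrix.add_mul, Matrix.smul_mul,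
      Matrix.mul_smul, qA, Aq, h2, Matrix.one_mul]
    push_cast
    module
  have e2 : M⁻¹ * cmpr Q (t • c) - (Q + (η : ℂ) • A) * C =
      ((η ^ 2 * t : ℝ) : ℂ) • (M⁻¹ * (A * A) * C) := by
    have : Q + (η : ℂ) • A = M⁻¹ * ((t : ℂ) • Q - ((η ^ 2 * t : ℝ) : ℂ) • (A * A)) := by
      rw [← e1, ← Matrix.mul_assoc, m1, Matrix.one_mul]
    rw [this, cmpr_smul, ← hC]
    simp only [Matrix.mul_sub, Matrix.sub_mul, Matrix.mul_smul, Matrix.smul_mul]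
    rw [Matrix.mul_assoc M⁻¹ Q C, qC]
    abel
  have e3 := congrArg (fun X => (Matrix.trace X).re) e2
  simp only [Matrix.trace_sub, Matrix.trace_smul, Complex.sub_re, smul_eq_mul,
    Complex.re_ofReal_mul] at e3
  have : 0 ≤ η ^ 2 * t * (M⁻¹ * (A * A) * C).trace.re :=
    mul_nonneg (by positivity) main
  linarith

lemma frame_mul {L : ℕ} (r s : ℕ) (hr : s + r ≤ L) :
    basisFrame L r s * (basisFrame L r s)ᴴ =
      Matrix.diagonal (fun i : Fin L => ((if s ≤ (i : ℕ) ∧ (i : ℕ) < s + r then 1 else 0 : ℝ) : ℂ)) := by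
  ext i j
  simp only [Matrix.mul_apply, basisFrame, Matrix.conjTranspose_apply, Matrix.of_apply,
    Matrix.diagonal_apply, apply_ite star, star_one, star_zero, mul_ite, mul_one, mul_zero]
  by_cases hi : s ≤ (i : ℕ) ∧ (i : ℕ) < s + r
  · have hk : (i : ℕ) - s < r := by omega
    rw [Finset.sum_eq_single (⟨(i : ℕ) - s, hk⟩ : Fin r)]
    · have e : s + ((i : ℕ) - s) = i := by omega
      simp only [e, if_true, hi, and_self, Complex.ofReal_one, Fin.ext_iff, eq_comm]
    · intro b _ hb
      have : (i : ℕ) ≠ s + b := by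
        intro hh; apply hb; ext; simp [hh]
      simp [this]
    · simp
  · rw [Finset.sum_eq_zero]
    · simp [hi]
    · intro k _
      have : (i : ℕ) ≠ s + k := by have := k.2; omega
      simp [this]

/-- Left-hand side trace. -/
lemma lhs_trace {L : ℕ} (Q : Matrix (Fin L) (Fin L) ℂ) (κ : ℕ → ℝ) (r s : ℕ) (hr : s + r ≤ L)
    (p : Fin L → ℝ) (hp : p = fun i : Fin L => if s ≤ (i : ℕ) ∧ (i : ℕ) < s + r then 1 else 0) :
    ((basisFrame L r s)ᴴ * grAct (Rmat κ L) Q * basisFrame L r s).trace =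
      ((cmprM Q (fun i => κ (L - i) ^ 2))⁻¹ * cmpr Q (fun i => κ (L - i) ^ 2 * p i)).trace := by
  have hR : (Rmat κ L)ᴴ = Rmat κ L := by
    simp only [Rmat, Matrix.diagonal_conjTranspose]
    congr 1; ext i; simp
  have hRR : Rmat κ L * Rmat κ L = Matrix.diagonal (fun i : Fin L => ((κ (L - i) ^ 2 : ℝ) : ℂ)) := by
    simp only [Rmat, Matrix.diagonal_mul_diagonal]
    congr 1; ext i; push_cast; ring
  have hRP : Rmat κ L * (basisFrame L r s * (basisFrame L r s)ᴴ) * Rmat κ L =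
      Matrix.diagonal (fun i : Fin L => ((κ (L - i) ^ 2 * p i : ℝ) : ℂ)) := by
    rw [frame_mul r s hr, Rmat, Matrix.diagonal_mul_diagonal, Matrix.diagonal_mul_diagonal, hp]
    congr 1; ext i; push_cast; ring
  have hM : Q * (Rmat κ L)ᴴ * Rmat κ L * Q + (1 - Q) = cmprM Q (fun i => κ (L - i) ^ 2) := by
    rw [hR, Matrix.mul_assoc Q, hRR]; rfl
  rw [grAct, hM, hR]
  set N := (cmprM Q (fun i => κ (L - i) ^ 2))⁻¹
  rw [cmpr, ← hRP, Matrix.trace_mul_comm]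
  have : basisFrame L r s * ((basisFrame L r s)ᴴ * (Rmat κ L * Q * N * (Q * Rmat κ L))) =
    (basisFrame L r s * (basisFrame L r s)ᴴ * Rmat κ L * Q) * (N * Q * Rmat κ L) := by
    simp only [Matrix.mul_assoc]
  rw [this, Matrix.trace_mul_comm]
  simp only [Matrix.mul_assoc]

/-- Right-hand side trace. -/
lemma rhs_trace {L : ℕ} (Q : Matrix (Fin L) (Fin L) ℂ) (h2 : Q * Q = Q) (r s r' s' : ℕ)
    (hr : s + r ≤ L) (hr' : s' + r' ≤ L)
    (p p' : Fin L → ℝ) (hp : p = fun i : Fin L => if s ≤ (i : ℕ) ∧ (i : ℕ) < s + r then 1 else 0)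
    (hp' : p' = fun i : Fin L => if s' ≤ (i : ℕ) ∧ (i : ℕ) < s' + r' then 1 else 0) (c : ℂ) :
    ((basisFrame L r s)ᴴ * Q * (1 + c • (basisFrame L r' s' * (basisFrame L r' s')ᴴ)) * Q *
      basisFrame L r s).trace = ((Q + c • cmpr Q p') * cmpr Q p).trace := by
  have hP := frame_mul (L := L) r s hr
  have hP' := frame_mul (L := L) r' s' hr'
  set Z := Q + c • cmpr Q p' with hZ
  have e : Q * (1 + c • (basisFrame L r' s' * (basisFrame L r' s')ᴴ)) * Q = Z := by
    rw [hP', hZ, cmpr, hp']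
    simp only [Matrix.mul_add, Matrix.add_mul, Matrix.mul_smul, Matrix.smul_mul, Matrix.mul_one, h2]
  have e' : Q * (Z * Q) = Z := by
    simp only [hZ, Matrix.mul_add, Matrix.add_mul, Matrix.mul_smul, Matrix.smul_mul, h2,
      Q_cmpr Q h2, cmpr_Q Q h2]
  have e1 : (basisFrame L r s)ᴴ * Q * (1 + c • (basisFrame L r' s' * (basisFrame L r' s')ᴴ)) * Q *
      basisFrame L r s = (basisFrame L r s)ᴴ * (Z * basisFrame L r s) := by
    rw [← e]; simp only [Matrix.mul_assoc]
  have e2 : Z * cmpr Q p = (Z * Q * (basisFrame L r s * (basisFrame L r s)ᴴ)) * Q := by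
    rw [hP, cmpr, hp]; simp only [Matrix.mul_assoc]
  rw [e1, e2, Matrix.trace_mul_comm, Matrix.trace_mul_comm _ Q, ← Matrix.mul_assoc Q, e',
    Matrix.mul_assoc]

end helperLemmas

/-- trace contraction by the hyperbolic action, macroscopic gap `𝜼`:
`tr[α̂*(ℛ·Q)α̂] ≤ tr[α̂*Q(1 − 𝜼·γ̂γ̂*)Qα̂]` and `tr[γ̂*(ℛ·Q)γ̂] ≥ tr[γ̂*Q(1 + 𝜼·α̂α̂*)Qγ̂]`
with `𝜼 = η(L_c, L_b+L_c)`; `α̂` is the frame of the first `L_a` and `γ̂` that of the last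
`L_c` standard basis vectors. (All quantities are real; we compare real parts.) -/
theorem statement4 (L La Lb Lc q : ℕ) (hL : L = La + Lb + Lc)
    (κ : ℕ → ℝ)
    (hκpos : ∀ i, 1 ≤ i → i ≤ L → 0 < κ i)
    (hκmono : ∀ i j, 1 ≤ i → i ≤ j → j ≤ L → κ j ≤ κ i)
    (Q : Matrix (Fin L) (Fin L) ℂ) (hQ : IsProjOfRank q Q) :
    ((basisFrame L La 0)ᴴ * grAct (Rmat κ L) Q * basisFrame L La 0).trace.re ≤
      ((basisFrame L La 0)ᴴ * Q *
          (1 - ((eta κ Lc (Lb + Lc) : ℝ) : ℂ) •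
            (basisFrame L Lc (La + Lb) * (basisFrame L Lc (La + Lb))ᴴ)) * Q *
          basisFrame L La 0).trace.re ∧
    ((basisFrame L Lc (La + Lb))ᴴ * grAct (Rmat κ L) Q * basisFrame L Lc (La + Lb)).trace.re ≥
      ((basisFrame L Lc (La + Lb))ᴴ * Q *
          (1 + ((eta κ Lc (Lb + Lc) : ℝ) : ℂ) •
            (basisFrame L La 0 * (basisFrame L La 0)ᴴ)) * Q *
          basisFrame L Lc (La + Lb)).trace.re := by
  obtain ⟨h2, h, -⟩ := hQ
  set d : Fin L → ℝ := fun i => κ (L - i) ^ 2 with hd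
  set a : Fin L → ℝ := fun i => if 0 ≤ (i : ℕ) ∧ (i : ℕ) < 0 + La then 1 else 0 with ha
  set c : Fin L → ℝ := fun i => if La + Lb ≤ (i : ℕ) ∧ (i : ℕ) < La + Lb + Lc then 1 else 0 with hc
  have hd0 : ∀ i, 0 < d i := fun i => by
    have := hκpos (L - i) (by omega) (by omega)
    simp only [hd]; positivity
  have sqle : ∀ i j, 1 ≤ i → i ≤ j → j ≤ L → κ j ^ 2 ≤ κ i ^ 2 := fun i j h1 h2 h3 =>
    pow_le_pow_left₀ (hκpos j (by omega) h3).le (hκmono i j h1 h2 h3) 2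
  have a0 : ∀ i, 0 ≤ a i := fun i => by simp only [ha]; split_ifs <;> norm_num
  have a1 : ∀ i, a i ≤ 1 := fun i => by simp only [ha]; split_ifs <;> norm_num
  have c0 : ∀ i, 0 ≤ c i := fun i => by simp only [hc]; split_ifs <;> norm_num
  have c1 : ∀ i, c i ≤ 1 := fun i => by simp only [hc]; split_ifs <;> norm_num
  have acases : ∀ i : Fin L, ((i : ℕ) < La ∧ a i = 1 ∧ c i = 0) ∨
      ((La ≤ (i : ℕ) ∧ (i : ℕ) < La + Lb) ∧ a i = 0 ∧ c i = 0) ∨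
      (La + Lb ≤ (i : ℕ) ∧ a i = 0 ∧ c i = 1) := fun i => by
    have hi := i.2
    rcases lt_or_ge (i : ℕ) La with h1 | h1
    · left
      refine ⟨h1, ?_, ?_⟩
      · simp only [ha]; rw [if_pos (by omega)]
      · simp only [hc]; rw [if_neg (by omega)]
    · right
      rcases lt_or_ge (i : ℕ) (La + Lb) with h3 | h3
      · left
        refine ⟨⟨h1, h3⟩, ?_, ?_⟩
        · simp only [ha]; rw [if_neg (by omega)]
        · simp only [hc]; rw [if_neg (by omega)]
      · right
        refine ⟨h3, ?_, ?_⟩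
        · simp only [ha]; rw [if_neg (by omega)]
        · simp only [hc]; rw [if_pos (by omega)]
  have first : ∀ s t : ℝ, 0 < s → s ≤ t → (∀ i : Fin L, (i : ℕ) < La → d i ≤ s) →
      (∀ i : Fin L, La ≤ (i : ℕ) → (i : ℕ) < La + Lb → s ≤ d i) →
      (∀ i : Fin L, La + Lb ≤ (i : ℕ) → t ≤ d i) →
      ((cmprM Q d)⁻¹ * cmpr Q (fun i => d i * a i)).trace.re ≤
      ((Q - ((1 - s / t : ℝ) : ℂ) • cmpr Q c) * cmpr Q a).trace.re := by
    intro s t hs hst k1 k2 k3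
    refine le_trans ?_ (step_first Q h2 h a c a0 c0 c1 s t hs hst)
    have m := mono_tr Q h2 h (fun i => d i * a i) (s • a) (fun i => d i * (1 - a i))
      (fun i => s * (1 - a i - c i) + t * c i)
      (fun i => mul_nonneg (hd0 i).le (a0 i))
      (fun i => by rcases acases i with ⟨_, x, y⟩ | ⟨_, x, y⟩ | ⟨_, x, y⟩ <;> simp [x, y] <;> linarith)
      (fun i => by
        rcases acases i with ⟨z, x, y⟩ | ⟨z, x, y⟩ | ⟨z, x, y⟩ <;> simp [x]
        exact k1 i z)
      (fun i => by
        rcases acases i with ⟨z, x, y⟩ | ⟨z, x, y⟩ | ⟨z, x, y⟩ <;> simp [x, y]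
        · exact k2 i z.1 z.2
        · exact k3 i z)
      (fun i => by
        have := hd0 i
        rcases acases i with ⟨z, x, y⟩ | ⟨z, x, y⟩ | ⟨z, x, y⟩ <;> simp [x, y] <;> linarith)
    have f1 : (fun i => d i * a i) + (fun i => d i * (1 - a i)) = d := by
      ext i; simp only [Pi.add_apply]; ring
    have f2 : s • a + (fun i => s * (1 - a i - c i) + t * c i) = s • 1 + (t - s) • c := by
      ext i; simp only [Pi.add_apply, Pi.smul_apply, Pi.one_apply, smul_eq_mul]; ring
    rwa [f1, f2] at m
  have second : ∀ s t : ℝ, 0 < s → s ≤ t → (∀ i : Fin L, (i : ℕ) < La → d i ≤ s) →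
      (∀ i : Fin L, La ≤ (i : ℕ) → (i : ℕ) < La + Lb → d i ≤ t) →
      (∀ i : Fin L, La + Lb ≤ (i : ℕ) → t ≤ d i) →
      ((Q + ((1 - s / t : ℝ) : ℂ) • cmpr Q a) * cmpr Q c).trace.re ≤
      ((cmprM Q d)⁻¹ * cmpr Q (fun i => d i * c i)).trace.re := by
    intro s t hs hst k1 k2 k3
    have ht : 0 < t := hs.trans_le hst
    refine le_trans (step_second Q h2 h a c a0 c0 a1 s t hs hst) ?_
    have m := mono_tr Q h2 h (t • c) (fun i => d i * c i)
      (fun i => s * a i + t * (1 - a i - c i)) (fun i => d i * (1 - c i))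
      (fun i => mul_nonneg ht.le (c0 i))
      (fun i => mul_nonneg (hd0 i).le (sub_nonneg.2 (c1 i)))
      (fun i => by
        rcases acases i with ⟨z, x, y⟩ | ⟨z, x, y⟩ | ⟨z, x, y⟩ <;> simp [y]
        exact k3 i z)
      (fun i => by
        rcases acases i with ⟨z, x, y⟩ | ⟨z, x, y⟩ | ⟨z, x, y⟩ <;> simp [x, y]
        · exact k1 i z
        · exact k2 i z.1 z.2)
      (fun i => by
        have := hd0 i
        rcases acases i with ⟨z, x, y⟩ | ⟨z, x, y⟩ | ⟨z, x, y⟩ <;> simp [y] <;> linarith)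
    have f1 : (fun i => d i * c i) + (fun i => d i * (1 - c i)) = d := by
      ext i; simp only [Pi.add_apply]; ring
    have f2 : t • c + (fun i => s * a i + t * (1 - a i - c i)) = t • 1 + (s - t) • a := by
      ext i; simp only [Pi.add_apply, Pi.smul_apply, Pi.one_apply, smul_eq_mul]; ring
    rwa [f1, f2] at m
  have L1 := lhs_trace Q κ La 0 (by omega) a ha
  have L2 := lhs_trace Q κ Lc (La + Lb) (by omega) c hc
  have R1 := rhs_trace Q h2 La 0 Lc (La + Lb) (by omega) (by omega) a c ha hc
    (-((eta κ Lc (Lb + Lc) : ℝ) : ℂ))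
  have R2 := rhs_trace Q h2 Lc (La + Lb) La 0 (by omega) (by omega) c a hc ha
    ((eta κ Lc (Lb + Lc) : ℝ) : ℂ)
  rw [neg_smul, neg_smul, ← sub_eq_add_neg, ← sub_eq_add_neg] at R1
  rw [L1, L2, R1, R2, ge_iff_le]
  rcases Nat.eq_zero_or_pos Lc with hLc | hLc
  · have cz : c = 0 := by
      ext i
      rcases acases i with ⟨_, x, y⟩ | ⟨_, x, y⟩ | ⟨z, x, y⟩
      · exact y
      · exact y
      · have := i.2; omega
    have wz : cmpr Q 0 = 0 := by simp [cmpr]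
    have wz' : cmpr Q (fun i => d i * c i) = 0 := by
      rw [cz]; simp [cmpr]
    refine ⟨?_, ?_⟩
    · obtain ⟨s, hs, k1, k2⟩ : ∃ s : ℝ, 0 < s ∧ (∀ i : Fin L, (i : ℕ) < La → d i ≤ s) ∧
          (∀ i : Fin L, La ≤ (i : ℕ) → (i : ℕ) < La + Lb → s ≤ d i) := by
        rcases Nat.eq_zero_or_pos Lb with hLb | hLb
        · refine ⟨κ 1 ^ 2 + 1, by positivity, fun i _ => ?_, fun i _ _ => by omega⟩
          have := sqle 1 (L - i) le_rfl (by omega) (by omega)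
          simp only [hd]; linarith
        · refine ⟨κ Lb ^ 2, ?_, fun i _ => ?_, fun i _ _ => ?_⟩
          · have := hκpos Lb hLb (by omega)
            positivity
          · exact sqle Lb (L - i) (by omega) (by omega) (by omega)
          · exact sqle (L - i) Lb (by omega) (by omega) (by omega)
      have := first s s hs le_rfl k1 k2 (fun i _ => by omega)
      rw [cz, wz, smul_zero] at this ⊢
      exact this
    · rw [wz', cz, wz]; simp
  · have hs0 := hκpos (Lb + Lc) (by omega) (by omega)
    have ht0 := hκpos Lc (by omega) (by omega)
    have hs : 0 < κ (Lb + Lc) ^ 2 := by positivity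
    have hst := sqle Lc (Lb + Lc) (by omega) (by omega) (by omega)
    have k1 : ∀ i : Fin L, (i : ℕ) < La → d i ≤ κ (Lb + Lc) ^ 2 := fun i _ =>
      sqle (Lb + Lc) (L - i) (by omega) (by omega) (by omega)
    have k3 : ∀ i : Fin L, La + Lb ≤ (i : ℕ) → κ Lc ^ 2 ≤ d i := fun i _ =>
      sqle (L - i) Lc (by omega) (by omega) (by omega)
    exact ⟨first _ _ hs hst k1
        (fun i _ _ => sqle (L - i) (Lb + Lc) (by omega) (by omega) (by omega)) k3,
      second _ _ hs hst k1
        (fun i _ _ => sqle Lc (L - i) (by omega) (by omega) (by omega)) k3⟩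


end
end
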